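/- Let K/k be a V4-extension of number fields with k = Q and K imaginary biquadratic with quadratic subfields k1, k2, k3. Then h(K) = (1/2)·Q(K/Q)·h(k1)h(k2)h(k3), where Q(K/Q) = [E_K : E_{k1}E_{k2}E_{k3}]. -/

import Mathlib

namespace Kuroda
open NumberField Filter Topology Ideal

section Euler
variable (F : Type*) [Field F] [NumberField F]

/-- weight of an ideal -/
noncomputable def wt (s : ℝ) (I : Ideal (𝓞 F)) : ℝ := (absNorm I : ℝ) ^ (-s)

lemma wt_mul (s : ℝ) (I J : Ideal (𝓞 F)) : wt F s (I * J) = wt F s I * wt F s J := by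
  simp only [wt, map_mul, Nat.cast_mul]
  exact Real.mul_rpow (Nat.cast_nonneg _) (Nat.cast_nonneg _)

lemma wt_bot (s : ℝ) (hs : 1 < s) : wt F s ⊥ = 0 := by
  simp only [wt, absNorm_bot, Nat.cast_zero]
  exact Real.zero_rpow (by linarith)

lemma wt_one (s : ℝ) : wt F s 1 = 1 := by simp [wt]

lemma wt_nonneg (s : ℝ) (I : Ideal (𝓞 F)) : 0 ≤ wt F s I := by unfold wt; positivity

lemma zeta_summable (s : ℝ) (hs : 1 < s) :
    LSeriesSummable (fun n ↦ (Nat.card {I : Ideal (𝓞 F) // absNorm I = n} : ℂ)) s := by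
  refine LSeriesSummable_of_sum_norm_bigO (r := 1) ?_ zero_le_one (by simpa using hs)
  have h1 := (Ideal.tendsto_norm_le_div_atTop₀ F).comp tendsto_natCast_atTop_atTop
  have h2 : Tendsto (fun n : ℕ ↦ (∑ k ∈ Finset.Icc 1 n, ‖(Nat.card {I : Ideal (𝓞 F) // absNorm I = k} : ℂ)‖) / (n:ℝ)) atTop
      (𝓝 (dedekindZeta_residue F)) := by
    refine h1.congr fun n ↦ ?_
    simp only [Function.comp_apply, Nat.cast_le, Complex.norm_natCast, ← Nat.cast_sum]
    congr
    rw [← add_left_inj 1, ← card_norm_le_eq_card_norm_le_add_one,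
      show Finset.Icc 1 n = Finset.Ioc 0 n from Finset.Icc_succ_left_eq_Ioc _ _,
      show 1 = Nat.card {I : Ideal (𝓞 F) // absNorm I = 0} by simp [Ideal.absNorm_eq_zero_iff],
      Finset.sum_Ioc_add_eq_sum_Icc (n.zero_le),
      ← Finset.card_preimage_eq_sum_card_image_eq (fun k _ ↦ finite_setOfPred_absNorm_eq k)]
    simp [Set.coe_eq_subtype]
  have h3 := h2.isBigO_one ℝ
  have h4 := h3.mul (Asymptotics.isBigO_refl (fun n : ℕ ↦ (n:ℝ)) atTop)
  refine (h4.congr' ?_ ?_)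
  · filter_upwards [eventually_gt_atTop 0] with n hn
    field_simp
  · filter_upwards with n
    simp

lemma hasSum_wt (s : ℝ) (hs : 1 < s) : Summable (wt F s) ∧
    dedekindZeta F s = ((∑' I, wt F s I : ℝ) : ℂ) := by
  let e := Equiv.sigmaFiberEquiv (fun I : Ideal (𝓞 F) ↦ absNorm I)
  have hfin : ∀ n : ℕ, Finite {I : Ideal (𝓞 F) // absNorm I = n} := fun n ↦
    (finite_setOfPred_absNorm_eq n).to_subtype
  have hfib : ∀ n : ℕ, ∑' y : {I : Ideal (𝓞 F) // absNorm I = n}, wt F s (e ⟨n, y⟩) =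
      (Nat.card {I : Ideal (𝓞 F) // absNorm I = n} : ℝ) * (n:ℝ) ^ (-s) := by
    intro n
    have : ∀ y : {I : Ideal (𝓞 F) // absNorm I = n}, wt F s (e ⟨n, y⟩) = (n:ℝ) ^ (-s) := by
      intro y
      simp [e, wt, y.2]
    simp only [this, tsum_const]
    simp
  have hterm : ∀ n : ℕ, LSeries.term (fun n ↦ (Nat.card {I : Ideal (𝓞 F) // absNorm I = n} : ℂ)) s n
      = (((Nat.card {I : Ideal (𝓞 F) // absNorm I = n} : ℝ) * (n:ℝ) ^ (-s) : ℝ) : ℂ) := by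
    intro n
    rcases eq_or_ne n 0 with rfl | hn
    · rw [LSeries.term_zero, Nat.cast_zero, Real.zero_rpow (by linarith)]
      simp
    · rw [LSeries.term_of_ne_zero hn]
      push_cast
      rw [Complex.ofReal_cpow (Nat.cast_nonneg _)]
      push_cast
      rw [Complex.cpow_neg, div_eq_mul_inv]
  have hsumN : Summable (fun n : ℕ ↦ (Nat.card {I : Ideal (𝓞 F) // absNorm I = n} : ℝ) * (n:ℝ) ^ (-s)) := by
    have := zeta_summable F s hs
    unfold LSeriesSummable at this
    rw [show LSeries.term (fun n ↦ (Nat.card {I : Ideal (𝓞 F) // absNorm I = n} : ℂ)) s = _ from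
      funext hterm] at this
    exact_mod_cast this
  have hS : Summable (fun x ↦ wt F s (e x)) := by
    rw [summable_sigma_of_nonneg (fun x ↦ wt_nonneg F s _)]
    refine ⟨fun n ↦ ?_, ?_⟩
    · have := hfin n
      exact Summable.of_finite
    · simpa only [hfib] using hsumN
  refine ⟨e.summable_iff.mp hS, ?_⟩
  rw [← e.tsum_eq, hS.tsum_sigma]
  simp only [hfib]
  unfold dedekindZeta LSeries
  rw [Complex.ofReal_tsum]
  exact tsum_congr hterm

/-- sieved sum -/
lemma sieve (s : ℝ) (hs : 1 < s) (S : Finset (Ideal (𝓞 F))) (hS : ∀ P ∈ S, P ≠ ⊥ ∧ P.IsPrime) :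
    (∏ P ∈ S, (1 - wt F s P)) * (∑' I, wt F s I) =
      ∑' I, Set.indicator {I | ∀ P ∈ S, ¬ P ∣ I} (wt F s) I := by
  classical
  have hsum := (hasSum_wt F s hs).1
  induction S using Finset.induction_on with
  | empty => simp
  | insert Q S hQ ih =>
    rw [Finset.prod_insert hQ, mul_assoc, ih (fun P hP ↦ hS P (Finset.mem_insert_of_mem hP))]
    obtain ⟨hQ0, hQp⟩ := hS Q (Finset.mem_insert_self _ _)
    have hQprime : Prime Q := (Ideal.prime_iff_isPrime hQ0).mpr hQp
    have key : ∑' I, Set.indicator {I | (∀ P ∈ S, ¬ P ∣ I) ∧ Q ∣ I} (wt F s) I =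
        wt F s Q * ∑' I, Set.indicator {I | ∀ P ∈ S, ¬ P ∣ I} (wt F s) I := by
      rw [← tsum_mul_left]
      have hinj : Function.Injective (fun J : Ideal (𝓞 F) ↦ Q * J) := mul_right_injective₀ hQ0
      rw [← hinj.tsum_eq]
      · refine tsum_congr fun J ↦ ?_
        have hiff : (∀ P ∈ S, ¬ P ∣ Q * J) ↔ ∀ P ∈ S, ¬ P ∣ J := by
          refine forall₂_congr fun P hP ↦ not_congr ⟨fun h ↦ ?_, fun h ↦ h.mul_left _⟩
          obtain ⟨hP0, hPp⟩ := hS P (Finset.mem_insert_of_mem hP)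
          have hPprime : Prime P := (Ideal.prime_iff_isPrime hP0).mpr hPp
          rcases hPprime.dvd_or_dvd h with h | h
          · have := (hPprime.dvd_prime_iff_associated hQprime).mp h
            rw [associated_iff_eq] at this
            exact absurd (this ▸ hP) hQ
          · exact h
        simp only [Set.indicator_apply, Set.mem_ofPred_eq, hiff, dvd_mul_right, and_true, wt_mul]
        split_ifs <;> simp
      · intro I hI
        rw [Function.mem_support, Set.indicator_apply_ne_zero] at hI
        obtain ⟨J, rfl⟩ := hI.1.2
        exact ⟨J, rfl⟩
    rw [sub_mul, one_mul, ← key, ← Summable.tsum_sub (hsum.indicator _) (hsum.indicator _)]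
    refine tsum_congr fun I ↦ ?_
    simp only [Set.indicator_apply, Set.mem_ofPred_eq, Finset.forall_mem_insert]
    by_cases h1 : ∀ P ∈ S, ¬ P ∣ I <;> by_cases h2 : Q ∣ I <;> simp [h1, h2]

/-- primes of F over p -/
noncomputable def pO (p : ℕ) : Finset (Ideal (𝓞 F)) :=
  open Classical in
  if h : p.Prime then
    (IsDedekindDomain.primesOver_finite (span {(p:ℤ)})
      (hpm := @Int.ideal_span_isMaximal_of_prime p ⟨h⟩) (𝓞 F)).toFinset else ∅

lemma mem_pO {p : ℕ} (hp : p.Prime) {P : Ideal (𝓞 F)} :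
    P ∈ pO F p ↔ P.IsPrime ∧ P.LiesOver (span {(p:ℤ)}) := by
  simp [pO, hp, Ideal.primesOver]

lemma pO_ne_bot {p : ℕ} (hp : p.Prime) {P : Ideal (𝓞 F)} (h : P ∈ pO F p) : P ≠ ⊥ := by
  rintro rfl
  have := ((mem_pO F hp).mp h).2.over
  have h1 : (p:ℤ) ∈ (span {(p:ℤ)}) := mem_span_singleton_self _
  rw [this] at h1
  simp [Ideal.mem_comap, Ideal.under] at h1
  exact hp.ne_zero h1

lemma mem_pO_natCast {p : ℕ} (hp : p.Prime) {P : Ideal (𝓞 F)} (h : P ∈ pO F p) : (p : 𝓞 F) ∈ P := by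
  have := ((mem_pO F hp).mp h).2.over
  have h1 : (p:ℤ) ∈ (span {(p:ℤ)}) := mem_span_singleton_self _
  rw [this] at h1
  simpa [Ideal.mem_comap, Ideal.under] using h1

lemma pO_disj {p q : ℕ} (hp : p.Prime) (hq : q.Prime) (hpq : p ≠ q) : Disjoint (pO F p) (pO F q) := by
  rw [Finset.disjoint_left]
  intro P h1 h2
  have a := ((mem_pO F hp).mp h1).2.over
  have b := ((mem_pO F hq).mp h2).2.over
  rw [← b, Ideal.span_singleton_eq_span_singleton] at a
  have := Int.associated_iff_natAbs.mp a
  simp at this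
  exact hpq this

lemma exists_pO {I : Ideal (𝓞 F)} (h0 : I ≠ ⊥) (h1 : I ≠ 1) :
    ∃ p : ℕ, p.Prime ∧ ∃ P ∈ pO F p, P ∣ I := by
  obtain ⟨P, hP, hle⟩ := Ideal.exists_le_maximal I (by simpa using h1)
  have hP0 : P ≠ ⊥ := by rintro rfl; exact h0 (by simpa using hle)
  have hPp := hP.isPrime
  have hu : P.under ℤ ≠ ⊥ := Ideal.IsIntegral.comap_ne_bot _ hP0
  obtain ⟨n, hn⟩ := (inferInstance : (P.under ℤ).IsPrincipal).principal
  have hn' : P.under ℤ = span {n} := hn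
  have hup : (P.under ℤ).IsPrime := inferInstance
  have hn0 : n ≠ 0 := by
    rintro rfl
    exact hu (by simpa using hn')
  rw [hn', Ideal.span_singleton_prime hn0] at hup
  have hpp : (n.natAbs).Prime := Int.prime_iff_natAbs_prime.mp hup
  refine ⟨n.natAbs, hpp, P, (mem_pO F hpp).mpr ⟨hPp, ⟨?_⟩⟩, Ideal.dvd_iff_le.mpr hle⟩
  rw [hn', Ideal.span_singleton_eq_span_singleton]
  exact Int.associated_iff_natAbs.mpr (by simp [Int.natAbs_abs])

noncomputable def AN (s : ℝ) (N : ℕ) : ℝ := ∏ p ∈ N.primesBelow, ∏ P ∈ pO F p, (1 - wt F s P)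

lemma tendsto_AN (s : ℝ) (hs : 1 < s) :
    Tendsto (fun N ↦ AN F s N * ∑' I, wt F s I) atTop (𝓝 1) := by
  classical
  have hsum := (hasSum_wt F s hs).1
  have h1 : ∀ N, AN F s N * ∑' I, wt F s I =
      ∑' I, Set.indicator {I | ∀ P ∈ N.primesBelow.biUnion (pO F), ¬ P ∣ I} (wt F s) I := by
    intro N
    rw [← sieve F s hs, Finset.prod_biUnion, AN]
    · intro p hp q hq hpq
      exact pO_disj F (Nat.prime_of_mem_primesBelow hp) (Nat.prime_of_mem_primesBelow hq) hpq
    · intro P hP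
      obtain ⟨p, hp, hP⟩ := Finset.mem_biUnion.mp hP
      have hp := Nat.prime_of_mem_primesBelow hp
      exact ⟨pO_ne_bot F hp hP, ((mem_pO F hp).mp hP).1⟩
  simp only [h1]
  have h2 : (1:ℝ) = ∑' I : Ideal (𝓞 F), if I = 1 then (1:ℝ) else 0 := by
    rw [tsum_ite_eq]
  rw [h2]
  refine tendsto_tsum_of_dominated_convergence hsum (fun I ↦ ?_) ?_
  · refine tendsto_const_nhds.congr' ?_
    by_cases hI1 : I = 1
    · subst hI1
      filter_upwards with N
      rw [Set.indicator_of_mem, wt_one]; · simp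
      intro P hP hdvd
      obtain ⟨p, hp, hP⟩ := Finset.mem_biUnion.mp hP
      have hp := Nat.prime_of_mem_primesBelow hp
      have := ((mem_pO F hp).mp hP).1.ne_top
      exact this (by simpa using isUnit_of_dvd_one hdvd)
    · rw [if_neg hI1]
      by_cases hI0 : I = ⊥
      · subst hI0
        filter_upwards with N
        rw [Set.indicator_apply, wt_bot F s hs]; simp
      · obtain ⟨p, hp, P, hP, hd⟩ := exists_pO F hI0 hI1
        filter_upwards [eventually_gt_atTop p] with N hN
        rw [Set.indicator_of_notMem]
        intro hmem
        exact hmem P (Finset.mem_biUnion.mpr ⟨p, Nat.mem_primesBelow.mpr ⟨hN, hp⟩, hP⟩) hd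
  · filter_upwards with N I
    rw [Real.norm_eq_abs, abs_of_nonneg (Set.indicator_nonneg (fun _ _ ↦ wt_nonneg F s _) _)]
    exact Set.indicator_le_self' (fun _ _ ↦ wt_nonneg F s _) _

/-- local factor for Galois F -/
lemma local_factor [IsGalois ℚ F] (s : ℝ) {p : ℕ} (hp : p.Prime) :
    ∏ P ∈ pO F p, (1 - wt F s P) =
      (1 - ((p:ℝ) ^ (-s)) ^ ((span {(p:ℤ)}).inertiaDegIn (𝓞 F))) ^
        ((span {(p:ℤ)}).primesOver (𝓞 F)).ncard := by
  have hmax := @Int.ideal_span_isMaximal_of_prime p ⟨hp⟩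
  have hcard : ((span {(p:ℤ)}).primesOver (𝓞 F)).ncard = (pO F p).card := by
    rw [pO, dif_pos hp]; exact Set.ncard_eq_toFinset_card _ _
  rw [hcard, ← Finset.prod_const]
  refine Finset.prod_congr rfl fun P hP ↦ ?_
  obtain ⟨h1, h2⟩ := (mem_pO F hp).mp hP
  have hPmax : P.IsMaximal := h1.isMaximal (pO_ne_bot F hp hP)
  rw [wt, Ideal.absNorm_eq_pow_inertiaDeg' P hp, Ideal.inertiaDeg'_eq_inertiaDeg,
    Ideal.inertiaDegIn_eq_inertiaDeg (span {(p:ℤ)}) P Gal(F/ℚ)]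
  push_cast
  rw [← Real.rpow_natCast, ← Real.rpow_natCast, ← Real.rpow_mul (by positivity),
    ← Real.rpow_mul (by positivity), mul_comm]

end Euler
end Kuroda


namespace Kuroda
open NumberField Filter Topology Ideal

section Local

lemma card_subgroup_two {G : Type*} [Group G] (hG : Nat.card G = 2) {g : G} (hg : g ≠ 1)
    (H : Subgroup G) [Decidable (g ∈ H)] : Nat.card H = if g ∈ H then 2 else 1 := by
  have hd : Nat.card H ∣ 2 := hG ▸ H.card_subgroup_dvd_card
  have : Finite G := Nat.finite_of_card_ne_zero (by omega)
  rcases (Nat.dvd_prime Nat.prime_two).mp hd with h | h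
  · have := Subgroup.card_eq_one.mp h
    subst this
    rw [if_neg (by simpa using hg), h]
  · have : H = ⊤ := Subgroup.eq_top_of_card_eq H (by rw [h, hG])
    subst this
    simp [hG]

variable (K : Type*) [Field K] [NumberField K] [IsGalois ℚ K]
variable (F : Type*) [Field F] [NumberField F] [Algebra F K]

open scoped Pointwise in
lemma tower (hF : Module.finrank ℚ F = 2) (hFK : Module.finrank F K = 2) {p : ℕ} (hp : p.Prime) (P : Ideal (𝓞 K))
    [P.IsPrime] [P.LiesOver (span {(p:ℤ)})] (τ : Gal(K/ℚ)) (hτ : τ ≠ 1)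
    (hfix : ∀ x : F, τ (algebraMap F K x) = algebraMap F K x)
    [Decidable (τ ∈ P.inertia Gal(K/ℚ))] [Decidable (τ ∈ MulAction.stabilizer Gal(K/ℚ) P)] :
    (span {(p:ℤ)}).ramificationIdxIn (𝓞 F) * (if τ ∈ P.inertia Gal(K/ℚ) then 2 else 1) =
      (span {(p:ℤ)}).ramificationIdxIn (𝓞 K) ∧
    ((span {(p:ℤ)}).ramificationIdxIn (𝓞 F) * (span {(p:ℤ)}).inertiaDegIn (𝓞 F))
      * (if τ ∈ MulAction.stabilizer Gal(K/ℚ) P then 2 else 1) =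
      ((span {(p:ℤ)}).ramificationIdxIn (𝓞 K) * (span {(p:ℤ)}).inertiaDegIn (𝓞 K)) ∧
    ((span {(p:ℤ)}).primesOver (𝓞 F)).ncard * ((span {(p:ℤ)}).ramificationIdxIn (𝓞 F) * (span {(p:ℤ)}).inertiaDegIn (𝓞 F)) = 2 := by
  have hmax := @Int.ideal_span_isMaximal_of_prime p ⟨hp⟩
  have hprime := hmax.isPrime
  have : IsGalois F K := IsGalois.tower_top_of_isGalois ℚ F K
  have : Algebra.IsQuadraticExtension ℚ F := ⟨hF⟩
  have : IsGalois ℚ F := inferInstance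
  let q : Ideal (𝓞 F) := P.under (𝓞 F)
  have hq : q.LiesOver (span {(p:ℤ)}) := inferInstance
  have : P.LiesOver q := inferInstance
  have hq0 : q ≠ ⊥ := by
    have : span {(p:ℤ)} ≠ ⊥ := by simp [hp.ne_zero]
    exact Ideal.ne_bot_of_liesOver_of_ne_bot this q
  have hqm : q.IsMaximal := (inferInstance : q.IsPrime).isMaximal hq0
  have : Finite (𝓞 F ⧸ q) := Ideal.finiteQuotientOfFreeOfNeBot q hq0
  have : Module.Finite (𝓞 F) (𝓞 K) := Module.Finite.of_restrictScalars_finite ℤ _ _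
  have : FaithfulSMul (𝓞 F) (𝓞 K) := (faithfulSMul_iff_algebraMap_injective _ _).mpr
    (RingOfIntegers.algebraMap.injective F K)
  have hcard : Nat.card Gal(K/F) = 2 := by rw [IsGalois.card_aut_eq_finrank, hFK]
  let τ' : Gal(K/F) := AlgEquiv.ofRingEquiv (f := (τ : K ≃+* K)) hfix
  have hτ' : τ' ≠ 1 := by
    intro h
    apply hτ
    ext x
    exact congrArg (fun σ : Gal(K/F) ↦ σ x) h
  have : Finite q.ResidueField :=
    Finite.of_surjective _ (Ideal.bijective_algebraMap_quotient_residueField q).2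
  have : PerfectField q.ResidueField := inferInstance
  classical
  have hact : ∀ x : 𝓞 K, τ' • x = τ • x := fun x ↦ rfl
  have hI : τ' ∈ P.inertia Gal(K/F) ↔ τ ∈ P.inertia Gal(K/ℚ) := Iff.rfl
  have hD : τ' ∈ MulAction.stabilizer Gal(K/F) P ↔ τ ∈ MulAction.stabilizer Gal(K/ℚ) P := Iff.rfl
  have e1 := Ideal.card_inertia_eq_ramificationIdxIn (G := Gal(K/F)) q P
  have e2 := Ideal.card_stabilizer_eq (G := Gal(K/F)) q P
  rw [card_subgroup_two hcard hτ'] at e1 e2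
  have t1 := Ideal.ramificationIdxIn_mul_ramificationIdxIn (p := span {(p:ℤ)}) q Gal(F/ℚ) (𝓞 K) Gal(K/ℚ) Gal(K/F)
  have t2 := Ideal.inertiaDegIn_mul_inertiaDegIn (span {(p:ℤ)}) q Gal(F/ℚ) (𝓞 K) Gal(K/ℚ) Gal(K/F)
  refine ⟨?_, ?_, ?_⟩
  · rw [← t1, ← e1]; simp only [hI]
  · rw [← t1, ← t2, mul_mul_mul_comm, ← e2]; simp only [hD]
  · rw [Ideal.ncard_primesOver_mul_ramificationIdxIn_mul_inertiaDegIn (span {(p:ℤ)}) (𝓞 F) Gal(F/ℚ),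
      IsGalois.card_aut_eq_finrank, hF]

lemma card_le_of_pow {R : Type*} [CommRing R] [IsDomain R] [Finite R] {n : ℕ} (hn : 1 < n)
    (h : ∀ y : R, y ^ n = y) : Nat.card R ≤ n := by
  classical
  let pol : Polynomial R := Polynomial.X ^ n - Polynomial.X
  have hdeg : pol.natDegree = n := by
    have := Polynomial.natDegree_sub_eq_left_of_natDegree_lt (p := (Polynomial.X ^ n : Polynomial R))
      (q := Polynomial.X) (by simpa using hn)
    rw [this]; simp
  have hne : pol ≠ 0 := by
    intro h0
    rw [h0] at hdeg
    simp at hdeg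
    omega
  have := Fintype.ofFinite R
  have h1 : (Finset.univ : Finset R) ⊆ pol.roots.toFinset := by
    intro y _
    rw [Multiset.mem_toFinset, Polynomial.mem_roots hne]
    simp [pol, h y]
  rw [Nat.card_eq_fintype_card, ← Finset.card_univ, ← hdeg]
  calc _ ≤ _ := Finset.card_le_card h1
    _ ≤ _ := Multiset.toFinset_card_le _
    _ ≤ _ := Polynomial.card_roots' _

lemma f_le_two (hV4 : ∀ σ : Gal(K/ℚ), σ * σ = 1) {p : ℕ} (hp : p.Prime) :
    (span {(p:ℤ)}).inertiaDegIn (𝓞 K) ≤ 2 := by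
  have hmax := @Int.ideal_span_isMaximal_of_prime p ⟨hp⟩
  have hprime := hmax.isPrime
  obtain ⟨⟨P, hP1, hP2⟩⟩ := (inferInstance : Nonempty ((span {(p:ℤ)}).primesOver (𝓞 K)))
  have hP0 : P ≠ ⊥ := by
    have : span {(p:ℤ)} ≠ ⊥ := by simp [hp.ne_zero]
    exact Ideal.ne_bot_of_liesOver_of_ne_bot this P
  have hPm : P.IsMaximal := hP1.isMaximal hP0
  have : Finite (𝓞 K ⧸ P) := Ideal.finiteQuotientOfFreeOfNeBot P hP0
  rw [Ideal.inertiaDegIn_eq_inertiaDeg (span {(p:ℤ)}) P Gal(K/ℚ), ← Ideal.inertiaDeg'_eq_inertiaDeg (span {(p:ℤ)})]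
  have hn := Ideal.absNorm_eq_pow_inertiaDeg' P hp
  rw [absNorm_apply, Submodule.cardQuot_apply] at hn
  obtain ⟨σ, hσ⟩ := IsArithFrobAt.exists_of_isInvariant ℤ Gal(K/ℚ) P
  have hcard : Nat.card (ℤ ⧸ P.under ℤ) = p := by
    rw [← hP2.over]
    simpa using Int.card_ideal_quot p
  have hfrob : ∀ x : 𝓞 K, Ideal.Quotient.mk P (σ • x) = Ideal.Quotient.mk P x ^ p := by
    intro x
    have := hσ.mk_apply x
    rw [hcard] at this
    exact this
  have hroot : ∀ y : 𝓞 K ⧸ P, y ^ (p ^ 2) = y := by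
    intro y
    obtain ⟨x, rfl⟩ := Ideal.Quotient.mk_surjective y
    have h2 := hfrob (σ • x)
    rw [hfrob x, ← mul_smul, hV4, one_smul, ← pow_mul, ← sq] at h2
    exact h2.symm
  have hp2 : 1 < p ^ 2 := Nat.one_lt_pow (by norm_num) hp.one_lt
  have hle : Nat.card (𝓞 K ⧸ P) ≤ p ^ 2 := card_le_of_pow hp2 hroot
  rw [hn] at hle
  exact (Nat.pow_le_pow_iff_right hp.one_lt).mp hle

lemma card_subgroup_four {G : Type*} [Group G] [DecidableEq G] (hG : Nat.card G = 4) {a b c : G} (ha : a ≠ 1) (hb : b ≠ 1)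
    (hc : c ≠ 1) (hab : a ≠ b) (hac : a ≠ c) (hbc : b ≠ c) (H : Subgroup G) [DecidablePred (· ∈ H)] :
    Nat.card H = 1 + (if a ∈ H then 1 else 0) + (if b ∈ H then 1 else 0) + (if c ∈ H then 1 else 0) := by
  have : Finite G := Nat.finite_of_card_ne_zero (by omega)
  have := Fintype.ofFinite G
  have huniv : ({1, a, b, c} : Finset G) = Finset.univ := by
    rw [← Finset.card_eq_iff_eq_univ, ← Nat.card_eq_fintype_card, hG]
    simp [*, Finset.card_insert_of_notMem, ha.symm, hb.symm, hc.symm]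
  rw [Nat.card_eq_fintype_card, Fintype.card_subtype, ← huniv, Finset.card_filter]
  clear huniv
  rw [Finset.sum_insert (by simp [ha.symm, hb.symm, hc.symm]), Finset.sum_insert (by simp [hab, hac]),
    Finset.sum_insert (by simp [hbc]), Finset.sum_singleton, if_pos H.one_mem]
  ring

lemma ite21 (q : Prop) [Decidable q] : (if q then 2 else 1) = 1 + (if q then 1 else 0) := by
  split_ifs <;> rfl

lemma ite_le_one (q : Prop) [Decidable q] : (if q then 1 else 0) ≤ 1 := by
  split_ifs <;> norm_num

lemma ite_le_of {q r : Prop} [Decidable q] [Decidable r] (h : q → r) :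
    (if q then 1 else 0) ≤ (if r then 1 else 0) := by
  split_ifs <;> simp_all

lemma ite_ne {q r t : Prop} [Decidable q] [Decidable r] [Decidable t] (h1 : q → r → t) (h2 : q → t → r)
    (h3 : r → t → q) : (if q then 1 else 0) + (if r then 1 else 0) + (if t then 1 else 0) ≠ 2 := by
  split_ifs <;> simp_all

lemma triple {e f g : ℕ} (h : g * (e * f) = 2) :
    (e = 1 ∧ f = 1 ∧ g = 2) ∨ (e = 1 ∧ f = 2 ∧ g = 1) ∨ (e = 2 ∧ f = 1 ∧ g = 1) := by
  have hg : g ∣ 2 := Dvd.intro _ h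
  have he : e ∣ 2 := ⟨g * f, by rw [← h]; ring⟩
  have hf : f ∣ 2 := ⟨g * e, by rw [← h]; ring⟩
  rcases (Nat.dvd_prime Nat.prime_two).mp hg with rfl | rfl <;>
  rcases (Nat.dvd_prime Nat.prime_two).mp he with rfl | rfl <;>
  rcases (Nat.dvd_prime Nat.prime_two).mp hf with rfl | rfl <;> simp_all

lemma quad {e f g : ℕ} (h : g * (e * f) = 4) (hf2 : f ≤ 2) :
    (e = 1 ∧ f = 1 ∧ g = 4) ∨ (e = 1 ∧ f = 2 ∧ g = 2) ∨ (e = 2 ∧ f = 1 ∧ g = 2) ∨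
      (e = 2 ∧ f = 2 ∧ g = 1) ∨ (e = 4 ∧ f = 1 ∧ g = 1) := by
  have he : e ∣ 4 := ⟨g * f, by rw [← h]; ring⟩
  have he4 : e ≤ 4 := Nat.le_of_dvd (by norm_num) he
  interval_cases e <;> interval_cases f <;> omega

lemma arith {e f g e1 f1 g1 e2 f2 g2 e3 f3 g3 u1 u2 u3 w1 w2 w3 : ℕ}
    (hu1 : u1 ≤ w1) (hu2 : u2 ≤ w2) (hu3 : u3 ≤ w3) (hw1 : w1 ≤ 1) (hw2 : w2 ≤ 1) (hw3 : w3 ≤ 1)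
    (hu : u1 + u2 + u3 ≠ 2) (hw : w1 + w2 + w3 ≠ 2) (hf : f ≤ 2)
    (a1 : e1 * (1 + u1) = e) (a2 : (e1 * f1) * (1 + w1) = e * f) (a3 : g1 * (e1 * f1) = 2)
    (b1 : e2 * (1 + u2) = e) (b2 : (e2 * f2) * (1 + w2) = e * f) (b3 : g2 * (e2 * f2) = 2)
    (c1 : e3 * (1 + u3) = e) (c2 : (e3 * f3) * (1 + w3) = e * f) (c3 : g3 * (e3 * f3) = 2)
    (h4 : g * (e * f) = 4) (hI : 1 + u1 + u2 + u3 = e) (hD : 1 + w1 + w2 + w3 = e * f) (x : ℝ) :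
    (1 - x ^ f) ^ g * (1 - x) ^ 2 =
      (1 - x ^ f1) ^ g1 * (1 - x ^ f2) ^ g2 * (1 - x ^ f3) ^ g3 := by
  rcases quad h4 hf with ⟨rfl, rfl, rfl⟩ | ⟨rfl, rfl, rfl⟩ | ⟨rfl, rfl, rfl⟩ | ⟨rfl, rfl, rfl⟩ | ⟨rfl, rfl, rfl⟩ <;>
  rcases triple a3 with ⟨rfl, rfl, rfl⟩ | ⟨rfl, rfl, rfl⟩ | ⟨rfl, rfl, rfl⟩ <;> try omega
  all_goals
    rcases triple b3 with ⟨rfl, rfl, rfl⟩ | ⟨rfl, rfl, rfl⟩ | ⟨rfl, rfl, rfl⟩ <;> try omega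
  all_goals
    rcases triple c3 with ⟨rfl, rfl, rfl⟩ | ⟨rfl, rfl, rfl⟩ | ⟨rfl, rfl, rfl⟩ <;> first | omega | ring

open scoped Pointwise in
lemma local_identity (hdeg : Module.finrank ℚ K = 4) (hV4 : ∀ σ : Gal(K/ℚ), σ * σ = 1)
    (F1 F2 F3 : Type*) [Field F1] [NumberField F1] [Algebra F1 K] [Field F2] [NumberField F2] [Algebra F2 K]
    [Field F3] [NumberField F3] [Algebra F3 K]
    (h1 : Module.finrank ℚ F1 = 2) (h2 : Module.finrank ℚ F2 = 2) (h3 : Module.finrank ℚ F3 = 2)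
    (t1 t2 t3 : Gal(K/ℚ)) (n1 : t1 ≠ 1) (n2 : t2 ≠ 1) (n3 : t3 ≠ 1) (n12 : t1 ≠ t2) (n13 : t1 ≠ t3) (n23 : t2 ≠ t3)
    (hf1 : ∀ x : F1, t1 (algebraMap F1 K x) = algebraMap F1 K x)
    (hf2 : ∀ x : F2, t2 (algebraMap F2 K x) = algebraMap F2 K x)
    (hf3 : ∀ x : F3, t3 (algebraMap F3 K x) = algebraMap F3 K x)
    (hmul : t1 * t2 = t3) {p : ℕ} (hp : p.Prime) (x : ℝ) :
    (1 - x ^ (span {(p:ℤ)}).inertiaDegIn (𝓞 K)) ^ ((span {(p:ℤ)}).primesOver (𝓞 K)).ncard * (1 - x) ^ 2 =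
    (1 - x ^ (span {(p:ℤ)}).inertiaDegIn (𝓞 F1)) ^ ((span {(p:ℤ)}).primesOver (𝓞 F1)).ncard *
    (1 - x ^ (span {(p:ℤ)}).inertiaDegIn (𝓞 F2)) ^ ((span {(p:ℤ)}).primesOver (𝓞 F2)).ncard *
    (1 - x ^ (span {(p:ℤ)}).inertiaDegIn (𝓞 F3)) ^ ((span {(p:ℤ)}).primesOver (𝓞 F3)).ncard := by
  classical
  have hmax := @Int.ideal_span_isMaximal_of_prime p ⟨hp⟩
  have hprime := hmax.isPrime
  obtain ⟨⟨P, hP1, hP2⟩⟩ := (inferInstance : Nonempty ((span {(p:ℤ)}).primesOver (𝓞 K)))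
  have hq1 : Module.finrank F1 K = 2 := by have := Module.finrank_mul_finrank ℚ F1 K; rw [h1, hdeg] at this; omega
  have hq2 : Module.finrank F2 K = 2 := by have := Module.finrank_mul_finrank ℚ F2 K; rw [h2, hdeg] at this; omega
  have hq3 : Module.finrank F3 K = 2 := by have := Module.finrank_mul_finrank ℚ F3 K; rw [h3, hdeg] at this; omega
  obtain ⟨a1, a2, a3⟩ := tower K F1 h1 hq1 hp P t1 n1 hf1
  obtain ⟨b1, b2, b3⟩ := tower K F2 h2 hq2 hp P t2 n2 hf2
  obtain ⟨c1, c2, c3⟩ := tower K F3 h3 hq3 hp P t3 n3 hf3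
  have hf := f_le_two K hV4 hp
  have hcard : Nat.card Gal(K/ℚ) = 4 := by rw [IsGalois.card_aut_eq_finrank, hdeg]
  have hefg := Ideal.ncard_primesOver_mul_ramificationIdxIn_mul_inertiaDegIn (span {(p:ℤ)}) (𝓞 K) Gal(K/ℚ)
  rw [hcard] at hefg
  have hI := Ideal.card_inertia_eq_ramificationIdxIn (G := Gal(K/ℚ)) (span {(p:ℤ)}) P
  have hD := Ideal.card_stabilizer_eq (G := Gal(K/ℚ)) (span {(p:ℤ)}) P
  rw [card_subgroup_four hcard n1 n2 n3 n12 n13 n23] at hI hD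
  have hle : P.inertia Gal(K/ℚ) ≤ MulAction.stabilizer Gal(K/ℚ) P := Ideal.inertia_le_stabilizer P
  have m1 : ∀ H : Subgroup Gal(K/ℚ), t1 ∈ H → t2 ∈ H → t3 ∈ H := fun H ha hb ↦ hmul ▸ H.mul_mem ha hb
  have m2 : ∀ H : Subgroup Gal(K/ℚ), t1 ∈ H → t3 ∈ H → t2 ∈ H := fun H ha hb ↦ by
    have : t2 = t1 * t3 := by rw [← hmul, ← mul_assoc, hV4, one_mul]
    exact this ▸ H.mul_mem ha hb
  have m3 : ∀ H : Subgroup Gal(K/ℚ), t2 ∈ H → t3 ∈ H → t1 ∈ H := fun H ha hb ↦ by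
    have : t1 = t3 * t2 := by rw [← hmul, mul_assoc, hV4, mul_one]
    exact this ▸ H.mul_mem hb ha
  rw [ite21] at a1 a2 b1 b2 c1 c2
  exact arith (ite_le_of (@hle t1)) (ite_le_of (@hle t2)) (ite_le_of (@hle t3)) (ite_le_one _)
    (ite_le_one _) (ite_le_one _) (ite_ne (m1 _) (m2 _) (m3 _)) (ite_ne (m1 _) (m2 _) (m3 _)) hf
    a1 a2 a3 b1 b2 b3 c1 c2 c3 hefg hI hD x

end Local
end Kuroda


namespace Kuroda
open NumberField Filter Topology Ideal

section Residue

lemma eq_of_tendsto_mul {X : ℕ → ℂ} {a b : ℂ} (ha : Tendsto (fun n ↦ X n * a) atTop (𝓝 1))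
    (hb : Tendsto (fun n ↦ X n * b) atTop (𝓝 1)) : a = b := by
  have h1 := ha.mul_const b
  have h2 := hb.mul_const a
  have : (fun n ↦ X n * a * b) = (fun n ↦ X n * b * a) := by ext n; ring
  rw [this] at h1
  simpa using tendsto_nhds_unique h2 h1

lemma tendsto_AN_complex (F : Type*) [Field F] [NumberField F] (s : ℝ) (hs : 1 < s) :
    Tendsto (fun N ↦ (AN F s N : ℂ) * dedekindZeta F s) atTop (𝓝 1) := by
  have h := tendsto_AN F s hs
  have h2 := (Complex.continuous_ofReal.tendsto 1).comp h
  rw [(hasSum_wt F s hs).2]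
  simpa [Function.comp_def] using h2

lemma tendsto_BN (s : ℝ) (hs : 1 < s) :
    Tendsto (fun N : ℕ ↦ ((∏ p ∈ N.primesBelow, (1 - (p:ℝ) ^ (-s)) : ℝ) : ℂ) * riemannZeta s) atTop (𝓝 1) := by
  have hs' : 1 < (s:ℂ).re := by simpa using hs
  have h0 := riemannZeta_ne_zero_of_one_lt_re hs'
  have h := ((riemannZeta_eulerProduct hs').inv₀ h0).mul_const (riemannZeta s)
  rw [inv_mul_cancel₀ h0] at h
  refine h.congr fun N ↦ ?_
  congr 1
  rw [← Finset.prod_inv_distrib]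
  push_cast
  refine Finset.prod_congr rfl fun p _ ↦ ?_
  rw [inv_inv, Complex.ofReal_cpow (by positivity)]
  simp

variable (K : Type*) [Field K] [NumberField K] [IsGalois ℚ K]

theorem residue_identity (hdeg : Module.finrank ℚ K = 4) (hV4 : ∀ σ : Gal(K/ℚ), σ * σ = 1)
    (F1 F2 F3 : Type*) [Field F1] [NumberField F1] [Algebra F1 K] [Field F2] [NumberField F2] [Algebra F2 K]
    [Field F3] [NumberField F3] [Algebra F3 K]
    (h1 : Module.finrank ℚ F1 = 2) (h2 : Module.finrank ℚ F2 = 2) (h3 : Module.finrank ℚ F3 = 2)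
    (t1 t2 t3 : Gal(K/ℚ)) (n1 : t1 ≠ 1) (n2 : t2 ≠ 1) (n3 : t3 ≠ 1) (n12 : t1 ≠ t2) (n13 : t1 ≠ t3) (n23 : t2 ≠ t3)
    (hf1 : ∀ x : F1, t1 (algebraMap F1 K x) = algebraMap F1 K x)
    (hf2 : ∀ x : F2, t2 (algebraMap F2 K x) = algebraMap F2 K x)
    (hf3 : ∀ x : F3, t3 (algebraMap F3 K x) = algebraMap F3 K x)
    (hmul : t1 * t2 = t3) :
    dedekindZeta_residue K = dedekindZeta_residue F1 * dedekindZeta_residue F2 * dedekindZeta_residue F3 := by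
  have : Algebra.IsQuadraticExtension ℚ F1 := ⟨h1⟩
  have : Algebra.IsQuadraticExtension ℚ F2 := ⟨h2⟩
  have : Algebra.IsQuadraticExtension ℚ F3 := ⟨h3⟩
  have : IsGalois ℚ F1 := inferInstance
  have : IsGalois ℚ F2 := inferInstance
  have : IsGalois ℚ F3 := inferInstance
  have key : ∀ s : ℝ, 1 < s → dedekindZeta K s * riemannZeta s ^ 2 =
      dedekindZeta F1 s * dedekindZeta F2 s * dedekindZeta F3 s := by
    intro s hs
    have hX : ∀ N, AN K s N * (∏ p ∈ N.primesBelow, (1 - (p:ℝ) ^ (-s))) ^ 2 = AN F1 s N * AN F2 s N * AN F3 s N := by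
      intro N
      unfold AN
      rw [← Finset.prod_pow, ← Finset.prod_mul_distrib, ← Finset.prod_mul_distrib, ← Finset.prod_mul_distrib]
      refine Finset.prod_congr rfl fun p hp ↦ ?_
      have hp := Nat.prime_of_mem_primesBelow hp
      rw [local_factor K s hp, local_factor F1 s hp, local_factor F2 s hp, local_factor F3 s hp]
      exact local_identity K hdeg hV4 F1 F2 F3 h1 h2 h3 t1 t2 t3 n1 n2 n3 n12 n13 n23 hf1 hf2 hf3 hmul hp _
    have ha := (tendsto_AN_complex K s hs).mul ((tendsto_BN s hs).pow 2)
    have hb := ((tendsto_AN_complex F1 s hs).mul (tendsto_AN_complex F2 s hs)).mul (tendsto_AN_complex F3 s hs)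
    simp only [one_pow, mul_one] at ha hb
    refine eq_of_tendsto_mul (X := fun N ↦ ((AN F1 s N * AN F2 s N * AN F3 s N : ℝ) : ℂ)) ?_ ?_
    · refine ha.congr fun N ↦ ?_
      rw [← hX]
      push_cast
      ring
    · refine hb.congr fun N ↦ ?_
      push_cast
      ring
  have hz : Tendsto (fun s : ℝ ↦ ((s:ℂ) - 1) * riemannZeta s) (𝓝[>] 1) (𝓝 1) := by
    refine riemannZeta_residue_one.comp ?_
    refine tendsto_nhdsWithin_iff.mpr ⟨?_, ?_⟩
    · exact (Complex.continuous_ofReal.tendsto 1).mono_left nhdsWithin_le_nhds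
    · filter_upwards [self_mem_nhdsWithin] with s hs
      have : (1:ℝ) < s := hs
      simp only [Set.mem_compl_iff, Set.mem_singleton_iff]
      exact_mod_cast this.ne'
  have ha := (tendsto_sub_one_mul_dedekindZeta_nhdsGT K).mul (hz.pow 2)
  have hb := ((tendsto_sub_one_mul_dedekindZeta_nhdsGT F1).mul (tendsto_sub_one_mul_dedekindZeta_nhdsGT F2)).mul
    (tendsto_sub_one_mul_dedekindZeta_nhdsGT F3)
  have : (dedekindZeta_residue K : ℂ) * 1 ^ 2 = dedekindZeta_residue F1 * dedekindZeta_residue F2 * dedekindZeta_residue F3 := by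
    refine tendsto_nhds_unique (ha.congr' ?_) hb
    filter_upwards [self_mem_nhdsWithin] with s hs
    have := key s hs
    linear_combination ((s:ℂ) - 1) ^ 3 * this
  rw [one_pow, mul_one] at this
  exact_mod_cast this

end Residue
end Kuroda


namespace Kuroda
open NumberField

section Quad

lemma exists_int_of_fixed {F : Type*} [Field F] [NumberField F] [IsGalois ℚ F] {z : F} (hz : IsIntegral ℤ z)
    (h : ∀ σ : Gal(F/ℚ), σ z = z) : ∃ a : ℤ, z = a := by
  have : z ∈ (⊥ : IntermediateField ℚ F) := (IsGalois.mem_bot_iff_fixed z).mpr h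
  obtain ⟨q, hq⟩ := IntermediateField.mem_bot.mp this
  have hq' : IsIntegral ℤ q := by
    rw [← hq] at hz
    exact (isIntegral_algebraMap_iff (algebraMap ℚ F).injective).mp hz
  obtain ⟨a, ha⟩ := IsIntegrallyClosed.isIntegral_iff.mp hq'
  refine ⟨a, ?_⟩
  rw [← hq, ← ha]
  simp

variable (F : Type*) [Field F] [NumberField F] 

lemma mul_self_mod_four (a b d : ℤ) (h : 4 ∣ a ^ 2 - b ^ 2 * d) : 2 ∣ a - b * d := by
  have h2 : (2:ℤ) ∣ a ^ 2 - b ^ 2 * d := Dvd.dvd.trans (by norm_num) h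
  rw [← even_iff_two_dvd] at h2 ⊢
  simp only [Int.even_sub, Int.even_pow, Int.even_mul, ne_eq, OfNat.ofNat_ne_zero, not_false_eq_true, and_true] at h2 ⊢
  exact h2

theorem quad_struct (hF : Module.finrank ℚ F = 2) :
    ∃ (δ : F) (σ : Gal(F/ℚ)), σ ≠ 1 ∧ δ ^ 2 = (discr F : ℤ) ∧ σ δ = -δ ∧
      (discr F % 4 = 0 ∨ discr F % 4 = 1) ∧
      (∀ z : F, IsIntegral ℤ z → ∃ a b : ℤ, 2 * z = a + b * δ ∧ 2 ∣ a - b * discr F) := by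
  have : Algebra.IsQuadraticExtension ℚ F := ⟨hF⟩
  have : IsGalois ℚ F := inferInstance
  have hcard : Nat.card Gal(F/ℚ) = 2 := by rw [IsGalois.card_aut_eq_finrank, hF]
  obtain ⟨σ, hσ⟩ : ∃ σ : Gal(F/ℚ), σ ≠ 1 := by
    have : Nontrivial Gal(F/ℚ) := by
      rw [← Finite.one_lt_card_iff_nontrivial, hcard]; norm_num
    exact exists_ne 1
  have hall : ∀ τ : Gal(F/ℚ), τ = 1 ∨ τ = σ := by
    intro τ
    obtain ⟨x, y, hxy, hu⟩ := Nat.card_eq_two_iff.mp hcard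
    have h1 : (1 : Gal(F/ℚ)) ∈ ({x, y} : Set _) := hu ▸ Set.mem_univ _
    have h2 : σ ∈ ({x, y} : Set _) := hu ▸ Set.mem_univ _
    have h3 : τ ∈ ({x, y} : Set _) := hu ▸ Set.mem_univ _
    simp only [Set.mem_insert_iff, Set.mem_singleton_iff] at h1 h2 h3
    aesop
  have hσσ : ∀ z, σ (σ z) = z := by
    intro z
    rcases hall (σ * σ) with h | h
    · exact congrArg (fun τ : Gal(F/ℚ) ↦ τ z) h
    · exact absurd (mul_eq_left.mp h) hσ
  have hfix : ∀ z : F, IsIntegral ℤ z → σ z = z → ∃ a : ℤ, z = a := by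
    intro z hz h
    refine exists_int_of_fixed hz fun τ ↦ ?_
    rcases hall τ with rfl | rfl
    · rfl
    · exact h
  have hint : ∀ z : F, IsIntegral ℤ z → IsIntegral ℤ (σ z) := fun z hz ↦ hz.map (σ.restrictScalars ℤ)
  have hrk : Module.finrank ℤ (𝓞 F) = 2 := by rw [RingOfIntegers.rank, hF]
  let b := Module.finBasisOfFinrankEq ℤ (𝓞 F) hrk
  set x : F := (b 0 : F) with hx
  set y : F := (b 1 : F) with hy
  have hxi : IsIntegral ℤ x := RingOfIntegers.isIntegral_coe _
  have hyi : IsIntegral ℤ y := RingOfIntegers.isIntegral_coe _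
  classical
  have htr : ∀ z : 𝓞 F, ((Algebra.trace ℤ (𝓞 F) z : ℤ) : F) = z + σ z := by
    intro z
    have h1 := trace_eq_sum_automorphisms (K := ℚ) (z : F)
    rw [← Algebra.coe_trace_int] at h1
    have huniv : (Finset.univ : Finset Gal(F/ℚ)) = {1, σ} := by
      ext τ; simpa using hall τ
    rw [huniv, Finset.sum_pair hσ.symm] at h1
    simpa using h1
  let δ : F := x * σ y - y * σ x
  have hδ2 : δ ^ 2 = (discr F : ℤ) := by
    rw [← discr_eq_discr F b, Algebra.discr_def, Matrix.det_fin_two]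
    simp only [Algebra.traceMatrix_apply, Algebra.traceForm_apply]
    push_cast
    rw [htr, htr, htr, htr]
    simp only [map_mul, ← hx, ← hy, δ]
    ring
  have hδσ : σ δ = - δ := by
    simp only [δ, map_sub, map_mul, hσσ]; ring
  have hδi : IsIntegral ℤ δ := (hxi.mul (hint _ hyi)).sub (hyi.mul (hint _ hxi))
  have hd4 : discr F % 4 = 0 ∨ discr F % 4 = 1 := by
    obtain ⟨t, ht⟩ := hfix (x * σ y + y * σ x) ((hxi.mul (hint _ hyi)).add (hyi.mul (hint _ hxi)))
      (by simp only [map_add, map_mul, hσσ]; ring)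
    obtain ⟨n, hn⟩ := hfix (x * σ x * (y * σ y)) ((hxi.mul (hint _ hxi)).mul (hyi.mul (hint _ hyi)))
      (by simp only [map_mul, hσσ]; ring)
    have : discr F = t ^ 2 - 4 * n := by
      have : ((discr F : ℤ) : F) = ((t ^ 2 - 4 * n : ℤ) : F) := by
        rw [← hδ2]; push_cast; rw [← ht, ← hn]; simp only [δ]; ring
      exact_mod_cast this
    rw [this]
    rcases Int.even_or_odd' t with ⟨k, rfl | rfl⟩
    · left; ring_nf; omega
    · right; ring_nf; omega
  refine ⟨δ, σ, hσ, hδ2, hδσ, hd4, ?_⟩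
  intro z hz
  -- coordinates
  have hone : ∃ m n : ℤ, (1 : F) = m * x + n * y := by
    have := b.sum_repr 1
    rw [Fin.sum_univ_two] at this
    refine ⟨b.repr 1 0, b.repr 1 1, ?_⟩
    have h2 := congrArg (fun w : 𝓞 F ↦ (w : F)) this
    simp only [map_add, zsmul_eq_mul, map_mul, map_intCast, map_one] at h2
    exact h2.symm
  obtain ⟨m, n, hmn⟩ := hone
  have hz' : ∃ p q : ℤ, z = p * x + q * y := by
    have := b.sum_repr ⟨z, hz⟩
    rw [Fin.sum_univ_two] at this
    refine ⟨b.repr ⟨z, hz⟩ 0, b.repr ⟨z, hz⟩ 1, ?_⟩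
    have h2 := congrArg (fun w : 𝓞 F ↦ (w : F)) this
    simp only [map_add, zsmul_eq_mul, map_mul, map_intCast] at h2
    exact h2.symm
  obtain ⟨p, q, hpq⟩ := hz'
  have hmn' : (1 : F) = m * σ x + n * σ y := by
    have := congrArg σ hmn
    simpa using this
  obtain ⟨a, ha⟩ := hfix (z + σ z) (hz.add (hint _ hz)) (by simp only [map_add, hσσ]; ring)
  obtain ⟨c, hc⟩ := hfix (z * σ z) (hz.mul (hint _ hz)) (by simp only [map_mul, hσσ]; ring)
  have hdiff : z - σ z = ((p * n - q * m : ℤ) : F) * δ := by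
    have e : σ z = p * σ x + q * σ y := by rw [hpq]; simp
    rw [e, hpq]
    push_cast
    simp only [δ]
    linear_combination (p * x + q * y) * hmn' - (p * σ x + q * σ y) * hmn
  refine ⟨a, p * n - q * m, ?_, ?_⟩
  · rw [← ha, ← hdiff]; ring
  · refine mul_self_mod_four _ _ _ ?_
    refine ⟨c, ?_⟩
    have : ((a ^ 2 - (p * n - q * m) ^ 2 * discr F : ℤ) : F) = ((4 * c : ℤ) : F) := by
      push_cast
      push_cast at hδ2 hdiff
      rw [← ha, ← hc]
      linear_combination (((p:F) * n - q * m) ^ 2) * hδ2 + (z - σ z + (p * n - q * m) * δ) * hdiff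
    exact_mod_cast this

end Quad
end Kuroda


namespace Kuroda
open NumberField

section BQ

/-- Biquadratic data. -/
structure BQ (K : Type*) [Field K] [NumberField K] where
  t1 : Gal(K/ℚ)
  t2 : Gal(K/ℚ)
  t3 : Gal(K/ℚ)
  hall : ∀ τ : Gal(K/ℚ), τ = 1 ∨ τ = t1 ∨ τ = t2 ∨ τ = t3
  n1 : t1 ≠ 1
  n2 : t2 ≠ 1
  n3 : t3 ≠ 1
  n12 : t1 ≠ t2
  n13 : t1 ≠ t3
  n23 : t2 ≠ t3
  hsq : ∀ τ : Gal(K/ℚ), τ * τ = 1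
  δ1 : K
  δ2 : K
  δ3 : K
  d1 : ℤ
  d2 : ℤ
  d3 : ℤ
  s1 : δ1 ^ 2 = d1
  s2 : δ2 ^ 2 = d2
  s3 : δ3 ^ 2 = d3
  z1 : d1 ≠ 0
  z2 : d2 ≠ 0
  z3 : d3 ≠ 0
  a11 : t1 δ1 = δ1
  a12 : t1 δ2 = -δ2
  a13 : t1 δ3 = -δ3
  a21 : t2 δ1 = -δ1
  a22 : t2 δ2 = δ2
  a23 : t2 δ3 = -δ3
  a31 : t3 δ1 = -δ1
  a32 : t3 δ2 = -δ2
  a33 : t3 δ3 = δ3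
  m1 : d1 % 4 = 0 ∨ d1 % 4 = 1
  m2 : d2 % 4 = 0 ∨ d2 % 4 = 1
  m3 : d3 % 4 = 0 ∨ d3 % 4 = 1
  i1 : ∀ z : K, IsIntegral ℤ z → t1 z = z → ∃ a b : ℤ, 2 * z = a + b * δ1 ∧ 2 ∣ a - b * d1
  i2 : ∀ z : K, IsIntegral ℤ z → t2 z = z → ∃ a b : ℤ, 2 * z = a + b * δ2 ∧ 2 ∣ a - b * d2
  i3 : ∀ z : K, IsIntegral ℤ z → t3 z = z → ∃ a b : ℤ, 2 * z = a + b * δ3 ∧ 2 ∣ a - b * d3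

variable {K : Type*} [Field K] [NumberField K]

/-- swap the first two -/
def BQ.swap (B : BQ K) : BQ K where
  t1 := B.t2
  t2 := B.t1
  t3 := B.t3
  hall := fun τ ↦ by have := B.hall τ; tauto
  n1 := B.n2
  n2 := B.n1
  n3 := B.n3
  n12 := B.n12.symm
  n13 := B.n23
  n23 := B.n13
  hsq := B.hsq
  δ1 := B.δ2
  δ2 := B.δ1
  δ3 := B.δ3
  d1 := B.d2
  d2 := B.d1
  d3 := B.d3
  s1 := B.s2
  s2 := B.s1
  s3 := B.s3
  z1 := B.z2
  z2 := B.z1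
  z3 := B.z3
  a11 := B.a22
  a12 := B.a21
  a13 := B.a23
  a21 := B.a12
  a22 := B.a11
  a23 := B.a13
  a31 := B.a32
  a32 := B.a31
  a33 := B.a33
  m1 := B.m2
  m2 := B.m1
  m3 := B.m3
  i1 := B.i2
  i2 := B.i1
  i3 := B.i3

/-- rotate -/
def BQ.rot (B : BQ K) : BQ K where
  t1 := B.t2
  t2 := B.t3
  t3 := B.t1
  hall := fun τ ↦ by have := B.hall τ; tauto
  n1 := B.n2
  n2 := B.n3
  n3 := B.n1
  n12 := B.n23
  n13 := B.n12.symm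
  n23 := B.n13.symm
  hsq := B.hsq
  δ1 := B.δ2
  δ2 := B.δ3
  δ3 := B.δ1
  d1 := B.d2
  d2 := B.d3
  d3 := B.d1
  s1 := B.s2
  s2 := B.s3
  s3 := B.s1
  z1 := B.z2
  z2 := B.z3
  z3 := B.z1
  a11 := B.a22
  a12 := B.a23
  a13 := B.a21
  a21 := B.a32
  a22 := B.a33
  a23 := B.a31
  a31 := B.a12
  a32 := B.a13
  a33 := B.a11
  m1 := B.m2
  m2 := B.m3
  m3 := B.m1
  i1 := B.i2
  i2 := B.i3
  i3 := B.i1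

lemma isIntegral_of_sq {L : Type*} [Field L] [CharZero L] {x : L} {n : ℤ} (h : x ^ 2 = n) : IsIntegral ℤ x := by
  refine IsIntegral.of_pow (n := 2) (by norm_num) ?_
  rw [h]
  exact isIntegral_algebraMap (R := ℤ) (A := L) (x := n)

lemma isIntegral_int {L : Type*} [Field L] (n : ℤ) : IsIntegral ℤ (n : L) :=
  isIntegral_algebraMap (R := ℤ) (A := L) (x := n)

lemma isIntegral_omega {L : Type*} [Field L] [CharZero L] {δ : L} {d : ℤ} (h : δ ^ 2 = d) (hd : d % 4 = 0 ∨ d % 4 = 1) :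
    IsIntegral ℤ ((d + δ) / 2) := by
  obtain ⟨k, hk⟩ : ∃ k : ℤ, d ^ 2 - d = 4 * k := by
    rcases hd with hd | hd
    · obtain ⟨m, rfl⟩ : ∃ m, d = 4 * m := ⟨d / 4, by omega⟩
      exact ⟨m * (4 * m) - m, by ring⟩
    · obtain ⟨m, rfl⟩ : ∃ m, d = 4 * m + 1 := ⟨d / 4, by omega⟩
      exact ⟨(4 * m + 1) * m, by ring⟩
  have hk' : (d:L) ^ 2 - d = 4 * k := by exact_mod_cast hk
  refine ⟨Polynomial.X ^ 2 - Polynomial.C d * Polynomial.X + Polynomial.C k, ?_, ?_⟩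
  · monicity!
  · simp only [Polynomial.eval₂_add, Polynomial.eval₂_sub, Polynomial.eval₂_pow, Polynomial.eval₂_X, Polynomial.eval₂_mul,
      Polynomial.eval₂_C, algebraMap_int_eq, Int.coe_castRingHom]
    linear_combination (1/4) * h - (1/4) * hk'

variable (B : BQ K)
include B

lemma BQ.isGalois_fixed [IsGalois ℚ K] {z : K} (hz : IsIntegral ℤ z) (h1 : B.t1 z = z) (h2 : B.t2 z = z) (h3 : B.t3 z = z) :
    ∃ a : ℤ, z = a := by
  refine exists_int_of_fixed hz fun τ ↦ ?_
  rcases B.hall τ with h | h | h | h <;> rw [h]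
  · rfl
  · exact h1
  · exact h2
  · exact h3

lemma BQ.invol (τ : Gal(K/ℚ)) (x : K) : τ (τ x) = x := congrArg (fun σ : Gal(K/ℚ) ↦ σ x) (B.hsq τ)

lemma BQ.mul12 : B.t1 * B.t2 = B.t3 := by
  rcases B.hall (B.t1 * B.t2) with h | h | h | h
  · exact absurd (by rw [← B.hsq B.t2] at h; exact mul_right_cancel h) B.n12
  · exact absurd (mul_eq_left.mp h) B.n2
  · exact absurd (mul_eq_right.mp h) B.n1
  · exact h

lemma BQ.app12 (x : K) : B.t1 (B.t2 x) = B.t3 x := congrArg (fun σ : Gal(K/ℚ) ↦ σ x) B.mul12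

lemma BQ.app21 (x : K) : B.t2 (B.t1 x) = B.t3 x := B.swap.app12 x
lemma BQ.app23 (x : K) : B.t2 (B.t3 x) = B.t1 x := B.rot.app12 x
lemma BQ.app31 (x : K) : B.t3 (B.t1 x) = B.t2 x := B.rot.rot.app12 x
lemma BQ.app13 (x : K) : B.t1 (B.t3 x) = B.t2 x := B.rot.rot.app21 x
lemma BQ.app32 (x : K) : B.t3 (B.t2 x) = B.t1 x := B.rot.app21 x

lemma BQ.nz1 : B.δ1 ≠ 0 := fun h ↦ B.z1 (by have := B.s1; rw [h] at this; exact_mod_cast (by simpa using this.symm))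
lemma BQ.nz2 : B.δ2 ≠ 0 := B.rot.nz1
lemma BQ.nz3 : B.δ3 ≠ 0 := B.rot.nz2

/-- linear independence -/
lemma BQ.indep {a b c e : ℚ} (h : (a:K) + b * B.δ1 + c * B.δ2 + e * B.δ3 = 0) : a = 0 ∧ b = 0 ∧ c = 0 ∧ e = 0 := by
  have h1 := congrArg B.t1 h
  have h2 := congrArg B.t2 h
  have h3 := congrArg B.t3 h
  simp only [map_add, map_mul, map_zero, map_ratCast, B.a11, B.a12, B.a13, B.a21, B.a22, B.a23, B.a31, B.a32, B.a33] at h1 h2 h3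
  have e0 : (a:K) = 0 := by linear_combination (1/4) * (h + h1 + h2 + h3)
  have e1 : (b:K) * B.δ1 = 0 := by linear_combination (1/4) * (h + h1 - h2 - h3)
  have e2 : (c:K) * B.δ2 = 0 := by linear_combination (1/4) * (h - h1 + h2 - h3)
  have e3 : (e:K) * B.δ3 = 0 := by linear_combination (1/4) * (h - h1 - h2 + h3)
  have e1 := (mul_eq_zero.mp e1).resolve_right B.nz1
  have e2 := (mul_eq_zero.mp e2).resolve_right B.nz2
  have e3 := (mul_eq_zero.mp e3).resolve_right B.nz3
  exact ⟨by exact_mod_cast e0, by exact_mod_cast e1, by exact_mod_cast e2, by exact_mod_cast e3⟩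

lemma BQ.int_map {x : K} (hx : IsIntegral ℤ x) (τ : Gal(K/ℚ)) : IsIntegral ℤ (τ x) := by
  clear B
  exact hx.map (τ.restrictScalars ℤ)

lemma BQ.coords [IsGalois ℚ K] {x : K} (hx : IsIntegral ℤ x) : ∃ T v1 v2 v3 : ℤ, 4 * x = T + v1 * B.δ1 + v2 * B.δ2 + v3 * B.δ3 ∧
    2 ∣ T - v1 * B.d1 ∧ 2 ∣ T - v2 * B.d2 ∧ 2 ∣ T - v3 * B.d3 := by
  have k1 := B.int_map hx B.t1
  have k2 := B.int_map hx B.t2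
  have k3 := B.int_map hx B.t3
  obtain ⟨T, hT⟩ := B.isGalois_fixed (((hx.add k1).add k2).add k3)
    (by simp only [map_add, B.invol, B.app12, B.app13]; ring)
    (by simp only [map_add, B.invol, B.app21, B.app23]; ring)
    (by simp only [map_add, B.invol, B.app31, B.app32]; ring)
  obtain ⟨b1, v1, e1, f1⟩ := B.i1 (x + B.t1 x) (hx.add k1) (by simp only [map_add, B.invol]; ring)
  obtain ⟨b2, v2, e2, f2⟩ := B.i2 (x + B.t2 x) (hx.add k2) (by simp only [map_add, B.invol]; ring)
  obtain ⟨b3, v3, e3, f3⟩ := B.i3 (x + B.t3 x) (hx.add k3) (by simp only [map_add, B.invol]; ring)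
  have g1 := congrArg B.t2 e1
  have g2 := congrArg B.t3 e2
  have g3 := congrArg B.t1 e3
  simp only [map_add, map_mul, map_intCast, map_ofNat, B.a11, B.a12, B.a13, B.a21, B.a22, B.a23, B.a31, B.a32, B.a33, B.app21, B.app32, B.app13] at g1 g2 g3
  have q1 : b1 = T := by
    have : (b1:K) = T := by linear_combination (-1/2) * e1 + (-1/2) * g1 + hT
    exact_mod_cast this
  have q2 : b2 = T := by
    have : (b2:K) = T := by linear_combination (-1/2) * e2 + (-1/2) * g2 + hT
    exact_mod_cast this
  have q3 : b3 = T := by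
    have : (b3:K) = T := by linear_combination (-1/2) * e3 + (-1/2) * g3 + hT
    exact_mod_cast this
  subst q1 q2
  rw [q3] at e3 f3
  exact ⟨b2, v1, v2, v3, by linear_combination e1 + e2 + e3 - 2 * hT, f1, f2, f3⟩

lemma BQ.omega1 : IsIntegral ℤ ((B.d1 + B.δ1) / 2) := isIntegral_omega B.s1 B.m1
lemma BQ.omega2 : IsIntegral ℤ ((B.d2 + B.δ2) / 2) := isIntegral_omega B.s2 B.m2
lemma BQ.omega3 : IsIntegral ℤ ((B.d3 + B.δ3) / 2) := isIntegral_omega B.s3 B.m3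

lemma BQ.intδ1 : IsIntegral ℤ B.δ1 := isIntegral_of_sq B.s1
lemma BQ.intδ2 : IsIntegral ℤ B.δ2 := isIntegral_of_sq B.s2
lemma BQ.intδ3 : IsIntegral ℤ B.δ3 := isIntegral_of_sq B.s3

/-- `(c + δ1)/4` is never integral -/
lemma BQ.not_int1 {c : ℚ} (h : IsIntegral ℤ (((c:K) + B.δ1) / 4)) : False := by
  obtain ⟨a, b, h, -⟩ := B.i1 _ h (by rw [map_div₀, map_add, B.a11, map_ofNat, map_ratCast])
  have : ((c / 2 - a : ℚ) : K) + ((1/2 - b : ℚ) : K) * B.δ1 + (0:ℚ) * B.δ2 + (0:ℚ) * B.δ3 = 0 := by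
    push_cast
    linear_combination h
  have := (B.indep this).2.1
  have h2 : (1:ℚ) = 2 * b := by linarith
  have : (1:ℤ) = 2 * b := by exact_mod_cast h2
  omega

lemma BQ.not_int2 {c : ℚ} (h : IsIntegral ℤ (((c:K) + B.δ2) / 4)) : False := B.rot.not_int1 h
lemma BQ.not_int3 {c : ℚ} (h : IsIntegral ℤ (((c:K) + B.δ3) / 4)) : False := B.rot.rot.not_int1 h

lemma BQ.mod16_1 (h : B.d1 % 4 = 0) : B.d1 % 16 = 8 ∨ B.d1 % 16 = 12 := by
  obtain ⟨m, hm⟩ : ∃ m, B.d1 = 4 * m := ⟨B.d1 / 4, by omega⟩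
  by_contra hcon
  have hs : (B.δ1 / 2) ^ 2 = (m:ℤ) := by
    have := B.s1
    rw [hm] at this
    push_cast at this
    linear_combination (1/4) * this
  have hm' : m % 4 = 0 ∨ m % 4 = 1 := by omega
  have := isIntegral_omega hs hm'
  refine B.not_int1 (c := 2 * m) ?_
  convert this using 1
  push_cast
  ring

lemma BQ.mod16_2 (h : B.d2 % 4 = 0) : B.d2 % 16 = 8 ∨ B.d2 % 16 = 12 := B.rot.mod16_1 h
lemma BQ.mod16_3 (h : B.d3 % 4 = 0) : B.d3 % 16 = 8 ∨ B.d3 % 16 = 12 := B.rot.rot.mod16_1 h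

end BQ
end Kuroda


namespace Kuroda
open NumberField

section BQ2
variable {K : Type*} [Field K] [NumberField K] [IsGalois ℚ K] (B : BQ K)
include B

lemma BQ.trace (z : K) : ((Algebra.trace ℚ K z : ℚ) : K) = z + B.t1 z + B.t2 z + B.t3 z := by
  classical
  have h1 := trace_eq_sum_automorphisms (K := ℚ) z
  have huniv : (Finset.univ : Finset Gal(K/ℚ)) = {1, B.t1, B.t2, B.t3} := by
    ext τ; simpa using B.hall τ
  rw [huniv, Finset.sum_insert (by simp [B.n1.symm, B.n2.symm, B.n3.symm]), Finset.sum_insert (by simp [B.n12, B.n13]),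
    Finset.sum_pair B.n23] at h1
  simpa [add_assoc] using h1

lemma BQ.discr_e : Algebra.discr ℚ ![1, B.δ1, B.δ2, B.δ3] = 256 * B.d1 * B.d2 * B.d3 := by
  have hT : ∀ z (q : ℚ), z + B.t1 z + B.t2 z + B.t3 z = q → Algebra.trace ℚ K z = q := by
    intro z q h
    have := B.trace z
    rw [h] at this
    exact_mod_cast this
  have : Algebra.traceMatrix ℚ ![1, B.δ1, B.δ2, B.δ3] =
      Matrix.diagonal ![(4:ℚ), 4 * B.d1, 4 * B.d2, 4 * B.d3] := by
    have s1 := B.s1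
    have s2 := B.s2
    have s3 := B.s3
    ext i j
    rw [Algebra.traceMatrix_apply, Algebra.traceForm_apply]
    apply hT
    fin_cases i <;> fin_cases j <;>
      simp [B.a11, B.a12, B.a13, B.a21, B.a22, B.a23, B.a31, B.a32, B.a33, Matrix.diagonal] <;>
      first | ring1 | linear_combination 4 * s1 | linear_combination 4 * s2 | linear_combination 4 * s3
  rw [Algebra.discr_def, this, Matrix.det_diagonal]
  simp [Fin.prod_univ_four]
  ring

lemma BQ.discr_of_theta {θ : K} (hθ : IsIntegral ℤ θ) {c ε : ℤ} (h4 : 4 * θ = c + ε * B.δ1 + B.δ2 + B.δ3)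
    (hcond : ∀ (x : K) (T v1 v2 v3 : ℤ), IsIntegral ℤ x → 4 * x = T + v1 * B.δ1 + v2 * B.δ2 + v3 * B.δ3 →
      2 ∣ T - v1 * B.d1 → 2 ∣ T - v2 * B.d2 → 2 ∣ T - v3 * B.d3 → 2 ∣ v1 - ε * v3 ∧ 2 ∣ v2 - v3) :
    discr K = B.d1 * B.d2 * B.d3 := by
  obtain ⟨b, hb0, hb1, hb2, hb3⟩ : ∃ b : Fin 4 → 𝓞 K, (b 0 : K) = 1 ∧ (b 1 : K) = (B.d1 + B.δ1) / 2 ∧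
      (b 2 : K) = (B.d2 + B.δ2) / 2 ∧ (b 3 : K) = θ :=
    ⟨![1, ⟨_, B.omega1⟩, ⟨_, B.omega2⟩, ⟨_, hθ⟩], rfl, rfl, rfl, rfl⟩
  let P : Matrix (Fin 4) (Fin 4) ℚ := !![1, B.d1/2, B.d2/2, c/4; 0, 1/2, 0, ε/4; 0, 0, 1/2, 1/4; 0, 0, 0, 1/4]
  have hdet : P.det = 1/16 := by
    rw [Matrix.det_of_isUpperTriangular]
    · simp [Fin.prod_univ_four, P]; norm_num
    · intro i j hij
      fin_cases i <;> fin_cases j <;> simp_all [P]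
  have hbK : (fun i ↦ (b i : K)) = Matrix.vecMul ![1, B.δ1, B.δ2, B.δ3] (P.map (algebraMap ℚ K)) := by
    ext i
    fin_cases i <;> simp [hb0, hb1, hb2, hb3, P, Matrix.vecMul, dotProduct, Fin.sum_univ_four]
    · ring
    · ring
    · linear_combination (1/4) * h4
  have hdisc : Algebra.discr ℚ (fun i ↦ (b i : K)) = B.d1 * B.d2 * B.d3 := by
    rw [hbK, Algebra.discr_of_matrix_vecMul, B.discr_e, hdet]
    ring
  have hli : LinearIndependent ℤ b := by
    rw [Fintype.linearIndependent_iff]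
    intro g hg
    rw [Fin.sum_univ_four] at hg
    have h2 := congrArg (fun w : 𝓞 K ↦ (w : K)) hg
    simp only [map_add, map_zero, zsmul_eq_mul, map_mul, map_intCast, hb0, hb1, hb2, hb3] at h2
    have : ((g 0 + g 1 * B.d1 / 2 + g 2 * B.d2 / 2 + g 3 * c / 4 : ℚ) : K) + ((g 1 / 2 + g 3 * ε / 4 : ℚ) : K) * B.δ1 +
      ((g 2 / 2 + g 3 / 4 : ℚ) : K) * B.δ2 + ((g 3 / 4 : ℚ) : K) * B.δ3 = 0 := by
      push_cast
      linear_combination h2 - g 3 / 4 * h4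
    obtain ⟨e0, e1, e2, e3⟩ := B.indep this
    have k3 : (g 3 : ℚ) = 0 := by linarith
    rw [k3] at e0 e1 e2
    have k2 : (g 2 : ℚ) = 0 := by linarith
    have k1 : (g 1 : ℚ) = 0 := by linarith
    rw [k2, k1] at e0
    have k0 : (g 0 : ℚ) = 0 := by linarith
    intro i
    fin_cases i
    · exact_mod_cast k0
    · exact_mod_cast k1
    · exact_mod_cast k2
    · exact_mod_cast k3
  have hsp : ⊤ ≤ Submodule.span ℤ (Set.range b) := by
    rintro x -
    obtain ⟨T, v1, v2, v3, hx, p1, p2, p3⟩ := B.coords (RingOfIntegers.isIntegral_coe x)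
    obtain ⟨⟨m1, hm1⟩, ⟨m2, hm2⟩⟩ := hcond _ T v1 v2 v3 (RingOfIntegers.isIntegral_coe x) hx p1 p2 p3
    have hm1' : (v1:K) - ε * v3 = 2 * m1 := by exact_mod_cast hm1
    have hm2' : (v2:K) - v3 = 2 * m2 := by exact_mod_cast hm2
    have hint : IsIntegral ℤ ((x : K) - v3 * θ - m1 * ((B.d1 + B.δ1) / 2) - m2 * ((B.d2 + B.δ2) / 2)) :=
      (((RingOfIntegers.isIntegral_coe x).sub ((isIntegral_int v3).mul hθ)).sub
        ((isIntegral_int m1).mul B.omega1)).sub ((isIntegral_int m2).mul B.omega2)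
    have hrat : (x : K) - v3 * θ - m1 * ((B.d1 + B.δ1) / 2) - m2 * ((B.d2 + B.δ2) / 2) =
        (((T - v3 * c) / 4 - m1 * B.d1 / 2 - m2 * B.d2 / 2 : ℚ) : K) := by
      push_cast
      linear_combination (1/4) * hx - v3 / 4 * h4 + B.δ1 / 4 * hm1' + B.δ2 / 4 * hm2'
    obtain ⟨n, hn⟩ := B.isGalois_fixed hint (by rw [hrat, map_ratCast]) (by rw [hrat, map_ratCast])
      (by rw [hrat, map_ratCast])
    have : x = n • b 0 + m1 • b 1 + m2 • b 2 + v3 • b 3 := by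
      apply RingOfIntegers.coe_injective
      simp only [map_add, zsmul_eq_mul, map_mul, map_intCast, hb0, hb1, hb2, hb3]
      linear_combination hn
    rw [this]
    refine Submodule.add_mem _ (Submodule.add_mem _ (Submodule.add_mem _ ?_ ?_) ?_) ?_ <;>
      exact Submodule.smul_mem _ _ (Submodule.subset_span ⟨_, rfl⟩)
  let bas := Module.Basis.mk hli hsp
  have h1 := discr_eq_discr K bas
  have h2 : ((Algebra.discr ℤ bas : ℤ) : ℚ) = Algebra.discr ℚ (fun i ↦ (b i : K)) := by
    rw [Algebra.discr_def, Algebra.discr_def]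
    rw [← eq_intCast (Int.castRingHom ℚ), RingHom.map_det]
    congr 1
    ext i j
    simp only [RingHom.mapMatrix_apply, Matrix.map_apply, Algebra.traceMatrix_apply, Algebra.traceForm_apply, eq_intCast]
    rw [Algebra.coe_trace_int]
    simp [bas]
  rw [h1, hdisc] at h2
  exact_mod_cast h2

end BQ2
end Kuroda


namespace Kuroda
open NumberField

section BQ3

lemma no_sq (k : ℕ) : ∀ (N w : ℤ), (w % 4 = 2 ∨ w % 4 = 3) → N ^ 2 = 4 ^ k * w → False := by
  induction k with
  | zero =>
    intro N w hw h
    rw [pow_zero, one_mul] at h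
    rcases Int.even_or_odd' N with ⟨n, rfl | rfl⟩
    · ring_nf at h; omega
    · ring_nf at h; omega
  | succ k ih =>
    intro N w hw h
    rcases Int.even_or_odd' N with ⟨n, rfl | rfl⟩
    · refine ih n w hw ?_
      have e : (4:ℤ) ^ (k + 1) * w = 4 * (4 ^ k * w) := by ring
      rw [e] at h
      linarith
    · have : (2 * n + 1) ^ 2 = 4 * (4 ^ k * w) := by rw [h]; ring
      ring_nf at this; omega

lemma no_sq3 {N x y z : ℤ} (h : N ^ 2 = x * y * z) (k1 k2 k3 : ℕ) {w1 w2 w3 c1 c2 c3 : ℤ} (h1 : x = 4 ^ k1 * w1)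
    (h2 : y = 4 ^ k2 * w2) (h3 : z = 4 ^ k3 * w3) (e1 : w1 % 4 = c1) (e2 : w2 % 4 = c2) (e3 : w3 % 4 = c3)
    (hc : (c1 * c2 * c3) % 4 = 2 ∨ (c1 * c2 * c3) % 4 = 3) : False := by
  refine no_sq (k1 + k2 + k3) N (w1 * w2 * w3) ?_ ?_
  · have : (w1 * w2 * w3) % 4 = (c1 * c2 * c3) % 4 := by
      subst e1 e2 e3
      simp [Int.mul_emod]
    rwa [this]
  · rw [h, h1, h2, h3]; ring

lemma no_sq888 {N x y z : ℤ} (h : N ^ 2 = x * y * z) (h1 : x % 16 = 8) (h2 : y % 16 = 8) (h3 : z % 16 = 8) : False := by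
  obtain ⟨a, ha⟩ : ∃ a, x = 8 * (2 * a + 1) := ⟨x / 16, by omega⟩
  obtain ⟨b, hb⟩ : ∃ a, y = 8 * (2 * a + 1) := ⟨y / 16, by omega⟩
  obtain ⟨c, hc⟩ : ∃ a, z = 8 * (2 * a + 1) := ⟨z / 16, by omega⟩
  refine no_sq 4 N (2 * ((2 * a + 1) * (2 * b + 1) * (2 * c + 1))) ?_ ?_
  · left; ring_nf; omega
  · rw [h, ha, hb, hc]; ring

set_option maxHeartbeats 1000000 in
/-- the triple of discriminants has a square product, so only few types occur -/
lemma types {N x y z : ℤ} (h : N ^ 2 = x * y * z) (hx : x % 4 = 1 ∨ x % 16 = 8 ∨ x % 16 = 12)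
    (hy : y % 4 = 1 ∨ y % 16 = 8 ∨ y % 16 = 12) (hz : z % 4 = 1 ∨ z % 16 = 8 ∨ z % 16 = 12) :
    (x % 4 = 1 ∧ y % 4 = 1 ∧ z % 4 = 1) ∨
    (x % 4 = 1 ∧ y % 4 = 0 ∧ z % 4 = 0) ∨ (y % 4 = 1 ∧ z % 4 = 0 ∧ x % 4 = 0) ∨ (z % 4 = 1 ∧ x % 4 = 0 ∧ y % 4 = 0) ∨
    (x % 16 = 12 ∧ y % 16 = 8 ∧ z % 16 = 8) ∨ (y % 16 = 12 ∧ z % 16 = 8 ∧ x % 16 = 8) ∨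
    (z % 16 = 12 ∧ x % 16 = 8 ∧ y % 16 = 8) := by
  have cls : ∀ {x : ℤ}, (x % 4 = 1 ∨ x % 16 = 8 ∨ x % 16 = 12) → 
     ∃ (k : ℕ) (w c : ℤ), x = 4 ^ k * w ∧ w % 4 = c ∧ ((x % 4 = 1 ∧ c = 1) ∨ (x % 16 = 8 ∧ c = 2) ∨ (x % 16 = 12 ∧ c = 3)) := by
    intro x hx
    rcases hx with h | h | h
    · exact ⟨0, x, 1, by ring, h, by tauto⟩
    · exact ⟨1, x / 4, 2, by omega, by omega, by tauto⟩
    · exact ⟨1, x / 4, 3, by omega, by omega, by tauto⟩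
  obtain ⟨k1, w1, c1, a1, b1, e1⟩ := cls hx
  obtain ⟨k2, w2, c2, a2, b2, e2⟩ := cls hy
  obtain ⟨k3, w3, c3, a3, b3, e3⟩ := cls hz
  have key := fun hc ↦ no_sq3 h k1 k2 k3 a1 a2 a3 b1 b2 b3 hc
  have key2 := fun p q r ↦ no_sq888 h p q r
  rcases e1 with ⟨e1, rfl⟩ | ⟨e1, rfl⟩ | ⟨e1, rfl⟩ <;> rcases e2 with ⟨e2, rfl⟩ | ⟨e2, rfl⟩ | ⟨e2, rfl⟩ <;>
  rcases e3 with ⟨e3, rfl⟩ | ⟨e3, rfl⟩ | ⟨e3, rfl⟩ <;>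
  first
    | (exfalso; exact key2 e1 e2 e3)
    | (exfalso; refine key ?_; decide)
    | (clear key key2 hx hy hz a1 a2 a3 b1 b2 b3 h; omega)

variable {K : Type*} [Field K] [NumberField K] [IsGalois ℚ K] (B : BQ K)
include B

lemma BQ.exists_sq : ∃ N : ℤ, N ^ 2 = B.d1 * B.d2 * B.d3 := by
  obtain ⟨N, hN⟩ := B.isGalois_fixed ((B.intδ1.mul B.intδ2).mul B.intδ3)
    (by simp only [map_mul, B.a11, B.a12, B.a13]; ring)
    (by simp only [map_mul, B.a21, B.a22, B.a23]; ring)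
    (by simp only [map_mul, B.a31, B.a32, B.a33]; ring)
  refine ⟨N, ?_⟩
  have : ((N ^ 2 : ℤ) : K) = ((B.d1 * B.d2 * B.d3 : ℤ) : K) := by
    push_cast
    rw [← hN, ← B.s1, ← B.s2, ← B.s3]
    ring
  exact_mod_cast this

lemma BQ.norm_theta {θ : K} (hθ : IsIntegral ℤ θ) {T ε v2 v3 : ℤ} (h : 4 * θ = T + ε * B.δ1 + v2 * B.δ2 + v3 * B.δ3)
    (o2 : v2 % 2 = 1) (o3 : v3 % 2 = 1) : ∃ (θ' : K) (c : ℤ), IsIntegral ℤ θ' ∧ 4 * θ' = c + ε * B.δ1 + B.δ2 + B.δ3 := by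
  obtain ⟨k, rfl⟩ : ∃ k, v2 = 2 * k + 1 := ⟨v2 / 2, by omega⟩
  obtain ⟨l, rfl⟩ : ∃ k, v3 = 2 * k + 1 := ⟨v3 / 2, by omega⟩
  refine ⟨θ - k * ((B.d2 + B.δ2) / 2) - l * ((B.d3 + B.δ3) / 2), T - 2 * k * B.d2 - 2 * l * B.d3,
    (hθ.sub ((isIntegral_int k).mul B.omega2)).sub ((isIntegral_int l).mul B.omega3), ?_⟩
  push_cast at h ⊢
  linear_combination h

lemma BQ.half1 (h : B.d1 % 4 = 0) : IsIntegral ℤ (B.δ1 / 2) := by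
  obtain ⟨m, hm⟩ : ∃ m, B.d1 = 4 * m := ⟨B.d1 / 4, by omega⟩
  refine isIntegral_of_sq (n := m) ?_
  have := B.s1
  rw [hm] at this
  push_cast at this
  linear_combination (1/4) * this

lemma BQ.half2 (h : B.d2 % 4 = 0) : IsIntegral ℤ (B.δ2 / 2) := B.rot.half1 h
lemma BQ.half3 (h : B.d3 % 4 = 0) : IsIntegral ℤ (B.δ3 / 2) := B.rot.rot.half1 h

/-- an integral rational multiple of `δ1 δ2` -/
lemma BQ.prod12 {q : ℚ} (h : IsIntegral ℤ ((q : K) * (B.δ1 * B.δ2))) :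
    ∃ b : ℤ, 2 * ((q : K) * (B.δ1 * B.δ2)) = b * B.δ3 ∧ 2 ∣ b * B.d3 := by
  obtain ⟨a, b, h1, h2⟩ := B.i3 _ h (by simp only [map_mul, map_ratCast, B.a31, B.a32]; ring)
  have g := congrArg B.t1 h1
  simp only [map_mul, map_add, map_ratCast, map_intCast, map_ofNat, B.a11, B.a12, B.a13] at g
  have ha : a = 0 := by
    have : (a : K) = 0 := by linear_combination (-1/2) * (h1 + g)
    exact_mod_cast this
  subst ha
  refine ⟨b, by simpa using h1, by simpa using h2⟩

/-- exactly the second coordinate odd is impossible -/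
lemma BQ.excl2 {x : K} (hx : IsIntegral ℤ x) {T v1 v2 v3 : ℤ} (h : 4 * x = T + v1 * B.δ1 + v2 * B.δ2 + v3 * B.δ3)
    (p1 : v1 % 2 = 0) (p2 : v2 % 2 = 1) (p3 : v3 % 2 = 0) : False := by
  obtain ⟨j, rfl⟩ : ∃ k, v1 = 2 * k := ⟨v1 / 2, by omega⟩
  obtain ⟨k, rfl⟩ : ∃ k, v2 = 2 * k + 1 := ⟨v2 / 2, by omega⟩
  obtain ⟨l, rfl⟩ : ∃ k, v3 = 2 * k := ⟨v3 / 2, by omega⟩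
  have := ((hx.sub ((isIntegral_int j).mul B.omega1)).sub ((isIntegral_int k).mul B.omega2)).sub ((isIntegral_int l).mul B.omega3)
  refine B.not_int2 (c := T - 2 * j * B.d1 - 2 * k * B.d2 - 2 * l * B.d3) ?_
  have e : (((T - 2 * j * B.d1 - 2 * k * B.d2 - 2 * l * B.d3 : ℚ) : K) + B.δ2) / 4 =
      x - ↑j * ((↑B.d1 + B.δ1) / 2) - ↑k * ((↑B.d2 + B.δ2) / 2) - ↑l * ((↑B.d3 + B.δ3) / 2) := by
    push_cast at h ⊢
    linear_combination (-1/4) * h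
  rw [e]
  exact this

lemma BQ.excl3 {x : K} (hx : IsIntegral ℤ x) {T v1 v2 v3 : ℤ} (h : 4 * x = T + v1 * B.δ1 + v2 * B.δ2 + v3 * B.δ3)
    (p1 : v1 % 2 = 0) (p2 : v2 % 2 = 0) (p3 : v3 % 2 = 1) : False :=
  B.rot.excl2 (T := T) (v1 := v2) (v2 := v3) (v3 := v1) hx (by rw [h]; simp only [BQ.rot]; ring) p2 p3 p1

lemma BQ.excl1 {x : K} (hx : IsIntegral ℤ x) {T v1 v2 v3 : ℤ} (h : 4 * x = T + v1 * B.δ1 + v2 * B.δ2 + v3 * B.δ3)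
    (p1 : v1 % 2 = 1) (p2 : v2 % 2 = 0) (p3 : v3 % 2 = 0) : False :=
  B.swap.excl2 (T := T) (v1 := v2) (v2 := v1) (v3 := v3) hx (by rw [h]; simp only [BQ.swap]; ring) p2 p1 p3

/-- in the `(12, 8, 8)` type, coordinates `(1,1,0)` are impossible -/
lemma BQ.excl12 (hd1 : B.d1 % 16 = 12) (hd2 : B.d2 % 16 = 8) {x : K} (hx : IsIntegral ℤ x) {T v1 v2 v3 : ℤ}
    (h : 4 * x = T + v1 * B.δ1 + v2 * B.δ2 + v3 * B.δ3)
    (p1 : v1 % 2 = 1) (p2 : v2 % 2 = 1) (p3 : v3 % 2 = 0) : False := by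
  obtain ⟨j, rfl⟩ : ∃ k, v1 = 2 * k + 1 := ⟨v1 / 2, by omega⟩
  obtain ⟨k, rfl⟩ : ∃ k, v2 = 2 * k + 1 := ⟨v2 / 2, by omega⟩
  obtain ⟨l, rfl⟩ : ∃ k, v3 = 2 * k := ⟨v3 / 2, by omega⟩
  have hint := ((hx.sub ((isIntegral_int j).mul B.omega1)).sub ((isIntegral_int k).mul B.omega2)).sub ((isIntegral_int l).mul B.omega3)
  generalize hy : x - ↑j * ((↑B.d1 + B.δ1) / 2) - ↑k * ((↑B.d2 + B.δ2) / 2) - ↑l * ((↑B.d3 + B.δ3) / 2) = y at hint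
  obtain ⟨S, hS⟩ : ∃ S : ℤ, 4 * y = S + B.δ1 + B.δ2 := by
    refine ⟨T - 2 * j * B.d1 - 2 * k * B.d2 - 2 * l * B.d3, ?_⟩
    rw [← hy]
    push_cast at h ⊢
    linear_combination h
  have hS1 := congrArg B.t1 hS
  simp only [map_mul, map_add, map_intCast, map_ofNat, B.a11, B.a12] at hS1
  obtain ⟨a, b, e, f⟩ := B.i1 (y * B.t1 y) (hint.mul (B.int_map hint B.t1)) (by rw [map_mul, B.invol, mul_comm])
  have s1 := B.s1
  have s2 := B.s2
  have : ((2 * (S ^ 2 + B.d1 - B.d2) - 16 * a : ℚ) : K) + ((4 * S - 16 * b : ℚ) : K) * B.δ1 + (0 : ℚ) * B.δ2 + (0 : ℚ) * B.δ3 = 0 := by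
    push_cast
    linear_combination 16 * e - 2 * (4 * B.t1 y) * hS - 2 * (S + B.δ1 + B.δ2) * hS1 - 2 * s1 + 2 * s2
  obtain ⟨q1, q2, -⟩ := B.indep this
  have r2 : S = 4 * b := by
    have : (S:ℚ) = 4 * b := by linarith
    exact_mod_cast this
  have r1 : S ^ 2 + B.d1 - B.d2 = 8 * a := by
    have : (S:ℚ) ^ 2 + B.d1 - B.d2 = 8 * a := by linarith
    exact_mod_cast this
  subst r2
  obtain ⟨m, hm⟩ : ∃ m, B.d1 = 2 * m := ⟨B.d1 / 2, by omega⟩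
  obtain ⟨a', rfl⟩ : ∃ a', a = 2 * a' := by
    obtain ⟨g, hg⟩ := f
    refine ⟨g + b * m, ?_⟩
    rw [hm] at hg
    linear_combination hg
  ring_nf at r1
  omega

lemma BQ.typeA (h1 : B.d1 % 4 = 1) (h2 : B.d2 % 4 = 1) (h3 : B.d3 % 4 = 1) : discr K = B.d1 * B.d2 * B.d3 := by
  obtain ⟨b, hb, hb2⟩ := B.prod12 (q := 1) (by simpa using B.intδ1.mul B.intδ2)
  obtain ⟨q, rfl⟩ : ∃ q, b = 2 * q := by
    rcases Int.even_or_odd' b with ⟨n, rfl | rfl⟩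
    · exact ⟨n, rfl⟩
    · exfalso
      obtain ⟨m, hm⟩ : ∃ m, B.d3 = 2 * m + 1 := ⟨B.d3 / 2, by omega⟩
      rw [hm] at hb2
      ring_nf at hb2
      omega
  have hq : B.δ1 * B.δ2 = q * B.δ3 := by
    push_cast at hb
    linear_combination (1/2) * hb
  have hqq : q ^ 2 * B.d3 = B.d1 * B.d2 := by
    have : ((q ^ 2 * B.d3 : ℤ) : K) = ((B.d1 * B.d2 : ℤ) : K) := by
      push_cast
      rw [← B.s1, ← B.s2, ← B.s3]
      linear_combination -(B.δ1 * B.δ2 + q * B.δ3) * hq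
    exact_mod_cast this
  have hodd : q % 2 = 1 := by
    by_contra hcon
    obtain ⟨n, rfl⟩ : ∃ n, q = 2 * n := ⟨q / 2, by omega⟩
    obtain ⟨m, hm⟩ : ∃ m, B.d1 = 2 * m + 1 := ⟨B.d1 / 2, by omega⟩
    obtain ⟨k, hk⟩ : ∃ m, B.d2 = 2 * m + 1 := ⟨B.d2 / 2, by omega⟩
    rw [hm, hk] at hqq
    ring_nf at hqq
    omega
  obtain ⟨θ, c, hθ, h4⟩ := B.norm_theta (B.omega1.mul B.omega2) (T := B.d1 * B.d2) (ε := B.d2) (v2 := B.d1) (v3 := q)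
    (by push_cast; linear_combination hq) (by omega) hodd
  refine B.discr_of_theta hθ h4 ?_
  intro x T v1 v2 v3 _ _ e1 e2 e3
  obtain ⟨m1, hm1⟩ : ∃ m, B.d1 = 2 * m + 1 := ⟨B.d1 / 2, by omega⟩
  obtain ⟨m2, hm2⟩ : ∃ m, B.d2 = 2 * m + 1 := ⟨B.d2 / 2, by omega⟩
  obtain ⟨m3, hm3⟩ : ∃ m, B.d3 = 2 * m + 1 := ⟨B.d3 / 2, by omega⟩
  rw [hm1] at e1
  rw [hm2] at e2 ⊢
  rw [hm3] at e3
  ring_nf at e1 e2 e3 ⊢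
  omega

lemma BQ.typeB (h1 : B.d1 % 4 = 1) (h2 : B.d2 % 4 = 0) (h3 : B.d3 % 4 = 0) : discr K = B.d1 * B.d2 * B.d3 := by
  obtain ⟨q, hq, -⟩ := B.prod12 (q := 1/2) (by
    have e : ((1/2:ℚ):K) * (B.δ1 * B.δ2) = B.δ1 * (B.δ2 / 2) := by push_cast; ring
    rw [e]
    exact B.intδ1.mul (B.half2 h2))
  obtain ⟨q', hq', -⟩ := B.rot.rot.prod12 (q := 1/2) (by
    have e : ((1/2:ℚ):K) * (B.δ3 * B.δ1) = B.δ1 * (B.δ3 / 2) := by push_cast; ring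
    show IsIntegral ℤ (((1/2:ℚ):K) * (B.δ3 * B.δ1))
    rw [e]
    exact B.intδ1.mul (B.half3 h3))
  have hq' : 2 * (((1/2:ℚ):K) * (B.δ3 * B.δ1)) = q' * B.δ2 := hq'
  have hq : B.δ1 * B.δ2 = q * B.δ3 := by
    push_cast at hq
    linear_combination hq
  have hq' : B.δ1 * B.δ3 = q' * B.δ2 := by
    push_cast at hq'
    linear_combination hq'
  have hd : B.d1 = q * q' := by
    have : (B.d1 : K) * B.δ2 = ((q * q' : ℤ) : K) * B.δ2 := by
      push_cast
      rw [← B.s1]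
      linear_combination B.δ1 * hq + q * hq'
    have := mul_right_cancel₀ B.nz2 this
    exact_mod_cast this
  have hodd : q % 2 = 1 := by
    by_contra hcon
    obtain ⟨n, rfl⟩ : ∃ n, q = 2 * n := ⟨q / 2, by omega⟩
    rw [mul_assoc] at hd
    omega
  obtain ⟨θ, c, hθ, h4⟩ := B.norm_theta (B.omega1.mul (B.half2 h2)) (T := 0) (ε := 0) (v2 := B.d1) (v3 := q)
    (by push_cast; linear_combination hq) (by omega) hodd
  refine B.discr_of_theta hθ h4 ?_
  intro x T v1 v2 v3 hx h e1 e2 e3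
  have hv1 : v1 % 2 = 0 := by
    obtain ⟨m1, hm1⟩ : ∃ m, B.d1 = 2 * m + 1 := ⟨B.d1 / 2, by omega⟩
    obtain ⟨m2, hm2⟩ : ∃ m, B.d2 = 2 * m := ⟨B.d2 / 2, by omega⟩
    rw [hm1] at e1
    rw [hm2] at e2
    ring_nf at e1 e2
    omega
  refine ⟨by omega, ?_⟩
  by_contra hcon
  rcases Int.emod_two_eq_zero_or_one v2 with p | p
  · exact B.excl3 hx h hv1 p (by omega)
  · exact B.excl2 hx h hv1 p (by omega)

lemma BQ.typeC (h1 : B.d1 % 16 = 12) (h2 : B.d2 % 16 = 8) (h3 : B.d3 % 16 = 8) : discr K = B.d1 * B.d2 * B.d3 := by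
  obtain ⟨b, hb, -⟩ := B.rot.prod12 (q := 1/4) (by
    have e : ((1/4:ℚ):K) * (B.δ2 * B.δ3) = B.δ2 / 2 * (B.δ3 / 2) := by push_cast; ring
    show IsIntegral ℤ (((1/4:ℚ):K) * (B.δ2 * B.δ3))
    rw [e]
    exact (B.half2 (by omega)).mul (B.half3 (by omega)))
  have hb : 2 * (((1/4:ℚ):K) * (B.δ2 * B.δ3)) = b * B.δ1 := hb
  have hb : B.δ2 * B.δ3 = 2 * b * B.δ1 := by
    push_cast at hb
    linear_combination 2 * hb
  have hbb : 4 * (b ^ 2 * B.d1) = B.d2 * B.d3 := by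
    have : ((4 * (b ^ 2 * B.d1) : ℤ) : K) = ((B.d2 * B.d3 : ℤ) : K) := by
      push_cast
      rw [← B.s1, ← B.s2, ← B.s3]
      linear_combination -(B.δ2 * B.δ3 + 2 * b * B.δ1) * hb
    exact_mod_cast this
  obtain ⟨m1, hm1⟩ : ∃ m, B.d1 = 16 * m + 12 := ⟨B.d1 / 16, by omega⟩
  obtain ⟨m2, hm2⟩ : ∃ m, B.d2 = 16 * m + 8 := ⟨B.d2 / 16, by omega⟩
  obtain ⟨m3, hm3⟩ : ∃ m, B.d3 = 16 * m + 8 := ⟨B.d3 / 16, by omega⟩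
  obtain ⟨n, rfl⟩ : ∃ n, b = 2 * n := by
    rcases Int.even_or_odd' b with ⟨n, rfl | rfl⟩
    · exact ⟨n, rfl⟩
    · exfalso
      rw [hm1, hm2, hm3] at hbb
      ring_nf at hbb
      omega
  have hθ : IsIntegral ℤ ((B.δ2 + B.δ3) / 4) := by
    refine IsIntegral.of_pow (n := 2) (by norm_num) ?_
    have : ((B.δ2 + B.δ3) / 4) ^ 2 = ((m2 + m3 + 1 : ℤ) : K) + n * (B.δ1 / 2) := by
      have s2 := B.s2
      have s3 := B.s3
      rw [hm2] at s2
      rw [hm3] at s3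
      push_cast at s2 s3 hb ⊢
      linear_combination (1/16) * s2 + (1/16) * s3 + (1/8) * hb
    rw [this]
    exact (isIntegral_int _).add ((isIntegral_int _).mul (B.half1 (by omega)))
  have h4 : 4 * ((B.δ2 + B.δ3) / 4) = ((0:ℤ):K) + ((0:ℤ):K) * B.δ1 + B.δ2 + B.δ3 := by push_cast; ring
  refine B.discr_of_theta hθ h4 ?_
  intro x T v1 v2 v3 hx h e1 e2 e3
  have hsub : 4 * (x - (B.δ2 + B.δ3) / 4) = T + v1 * B.δ1 + ((v2 - 1 : ℤ) : K) * B.δ2 + ((v3 - 1 : ℤ) : K) * B.δ3 := by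
    push_cast
    linear_combination h
  have hv1 : v1 % 2 = 0 := by
    by_contra hcon
    rcases Int.emod_two_eq_zero_or_one v2 with p | p <;> rcases Int.emod_two_eq_zero_or_one v3 with q | q
    · exact B.excl1 hx h (by omega) p q
    · exact B.excl12 h1 h2 (hx.sub hθ) hsub (by omega) (by omega) (by omega)
    · exact B.excl12 h1 h2 hx h (by omega) p q
    · exact B.excl1 (hx.sub hθ) hsub (by omega) (by omega) (by omega)
  refine ⟨by omega, ?_⟩
  by_contra hcon
  rcases Int.emod_two_eq_zero_or_one v2 with p | p
  · exact B.excl3 hx h hv1 p (by omega)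
  · exact B.excl2 hx h hv1 p (by omega)

theorem BQ.discr_eq : discr K = B.d1 * B.d2 * B.d3 := by
  obtain ⟨N, hN⟩ := B.exists_sq
  have c1 : B.d1 % 4 = 1 ∨ B.d1 % 16 = 8 ∨ B.d1 % 16 = 12 := by
    rcases B.m1 with h | h
    · exact Or.inr (B.mod16_1 h)
    · exact Or.inl h
  have c2 : B.d2 % 4 = 1 ∨ B.d2 % 16 = 8 ∨ B.d2 % 16 = 12 := by
    rcases B.m2 with h | h
    · exact Or.inr (B.mod16_2 h)
    · exact Or.inl h
  have c3 : B.d3 % 4 = 1 ∨ B.d3 % 16 = 8 ∨ B.d3 % 16 = 12 := by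
    rcases B.m3 with h | h
    · exact Or.inr (B.mod16_3 h)
    · exact Or.inl h
  rcases types hN c1 c2 c3 with ⟨p, q, r⟩ | ⟨p, q, r⟩ | ⟨p, q, r⟩ | ⟨p, q, r⟩ | ⟨p, q, r⟩ | ⟨p, q, r⟩ | ⟨p, q, r⟩
  · exact B.typeA p q r
  · exact B.typeB p q r
  · rw [B.rot.typeB p q r]; simp only [BQ.rot]; ring
  · rw [B.rot.rot.typeB p q r]; simp only [BQ.rot]; ring
  · exact B.typeC p q r
  · rw [B.rot.typeC p q r]; simp only [BQ.rot]; ring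
  · rw [B.rot.rot.typeC p q r]; simp only [BQ.rot]; ring

end BQ3
end Kuroda


namespace Kuroda
open NumberField

section Constr

variable {K : Type*} [Field K] [NumberField K] [IsGalois ℚ K]

lemma four_all (hdeg : Module.finrank ℚ K = 4) {a b c : Gal(K/ℚ)} (n1 : a ≠ 1) (n2 : b ≠ 1) (n3 : c ≠ 1) (n12 : a ≠ b)
    (n13 : a ≠ c) (n23 : b ≠ c) (τ : Gal(K/ℚ)) : τ = 1 ∨ τ = a ∨ τ = b ∨ τ = c := by
  classical
  have hc : Fintype.card Gal(K/ℚ) = 4 := by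
    rw [← Nat.card_eq_fintype_card, IsGalois.card_aut_eq_finrank, hdeg]
  have : ({1, a, b, c} : Finset Gal(K/ℚ)) = Finset.univ := by
    apply Finset.eq_univ_of_card
    rw [hc]
    rw [Finset.card_insert_of_notMem, Finset.card_insert_of_notMem, Finset.card_insert_of_notMem, Finset.card_singleton]
    · simpa using n23
    · simpa using ⟨n12, n13⟩
    · simpa using ⟨n1.symm, n2.symm, n3.symm⟩
  have h := Finset.mem_univ τ
  rw [← this] at h
  simpa using h

lemma exists_t (hdeg : Module.finrank ℚ K = 4) (F : Type*) [Field F] [NumberField F] [Algebra F K]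
    (hF : Module.finrank ℚ F = 2) : ∃ t : Gal(K/ℚ), t ≠ 1 ∧ ∀ y, t y = y ↔ y ∈ (algebraMap F K).range := by
  classical
  have h2 : Module.finrank F K = 2 := by
    have := Module.finrank_mul_finrank ℚ F K
    rw [hdeg, hF] at this
    omega
  haveI : FiniteDimensional F K := FiniteDimensional.of_finrank_pos (by omega)
  haveI : IsGalois F K := IsGalois.tower_top_of_isGalois ℚ F K
  have hc : Nat.card Gal(K/F) = 2 := by rw [IsGalois.card_aut_eq_finrank, h2]
  obtain ⟨s, hs⟩ : ∃ s : Gal(K/F), s ≠ 1 := by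
    by_contra! hcon
    haveI : Subsingleton Gal(K/F) := ⟨fun a b ↦ by rw [hcon a, hcon b]⟩
    have := Nat.card_of_subsingleton (1 : Gal(K/F))
    omega
  have hall : ∀ u : Gal(K/F), u = 1 ∨ u = s := by
    intro u
    have : ({1, s} : Finset Gal(K/F)) = Finset.univ := by
      apply Finset.eq_univ_of_card
      rw [← Nat.card_eq_fintype_card, hc, Finset.card_pair hs.symm]
    have h := Finset.mem_univ u
    rw [← this] at h
    simpa using h
  refine ⟨s.restrictScalars ℚ, ?_, ?_⟩
  · intro h
    apply hs
    ext x
    exact congrArg (fun g : Gal(K/ℚ) ↦ g x) h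
  · intro y
    constructor
    · intro h
      have h : s y = y := h
      have := (IsGalois.mem_range_algebraMap_iff_fixed (F := F) y).2 (by
        intro f
        rcases hall f with rfl | rfl
        · rfl
        · exact h)
      simpa using this
    · rintro ⟨x, rfl⟩
      exact s.commutes x

lemma exists_delta (hdeg : Module.finrank ℚ K = 4) (hV4 : ∀ σ : Gal(K/ℚ), σ * σ = 1) (F : Type*) [Field F] [NumberField F] [Algebra F K]
    (hF : Module.finrank ℚ F = 2) {t : Gal(K/ℚ)} (ht : t ≠ 1) (hfix : ∀ y, t y = y ↔ y ∈ (algebraMap F K).range) :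
    ∃ δ : K, δ ^ 2 = (discr F : ℤ) ∧ t δ = δ ∧ (∀ τ : Gal(K/ℚ), τ ≠ 1 → τ ≠ t → τ δ = -δ) ∧
      (discr F % 4 = 0 ∨ discr F % 4 = 1) ∧
      ∀ z : K, IsIntegral ℤ z → t z = z → ∃ a b : ℤ, 2 * z = a + b * δ ∧ 2 ∣ a - b * discr F := by
  obtain ⟨δ, σ, hσ, hδ, hneg, hm, hint⟩ := quad_struct F hF
  have hsq : (algebraMap F K δ) ^ 2 = (discr F : ℤ) := by rw [← map_pow, hδ]; simp
  refine ⟨algebraMap F K δ, hsq, (hfix _).2 ⟨δ, rfl⟩, ?_, hm, ?_⟩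
  · intro τ h1 h2
    have : (τ (algebraMap F K δ)) ^ 2 = (algebraMap F K δ) ^ 2 := by
      rw [← map_pow, hsq, map_intCast]
    rcases sq_eq_sq_iff_eq_or_eq_neg.1 this with h | h
    · exfalso
      have htt : t * τ ≠ 1 := by
        intro h
        apply h2
        have := congrArg (fun x ↦ t * x) h
        simp only [← mul_assoc, hV4, one_mul, mul_one] at this
        exact this
      have hall := four_all hdeg ht h1 htt h2.symm (by intro h; apply h1; simpa using h.symm)
        (by intro h; apply ht; simpa using h.symm)
      have htδ := (hfix _).2 ⟨δ, rfl⟩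
      have : algebraMap F K δ ∈ Set.range (algebraMap ℚ K) := (IsGalois.mem_range_algebraMap_iff_fixed (F := ℚ) _).2 (by
        intro f
        rcases hall f with rfl | rfl | rfl | rfl
        · rfl
        · exact htδ
        · exact h
        · rw [AlgEquiv.mul_apply, h, htδ])
      obtain ⟨q, hq⟩ := this
      rw [IsScalarTower.algebraMap_apply ℚ F K] at hq
      have hq := (algebraMap F K).injective hq
      rw [← hq, AlgEquiv.commutes] at hneg
      have h0 : algebraMap ℚ F q = 0 := by linear_combination (1/2) * hneg
      rw [← hq, h0] at hδ
      have := discr_ne_zero F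
      apply this
      exact_mod_cast (by simpa using hδ.symm : ((discr F : ℤ) : F) = 0)
    · exact h
  · intro z hz hz2
    obtain ⟨x, rfl⟩ := (hfix z).1 hz2
    obtain ⟨a, b, h1, h2⟩ := hint x ((isIntegral_algebraMap_iff (algebraMap F K).injective).1 hz)
    refine ⟨a, b, ?_, h2⟩
    have := congrArg (algebraMap F K) h1
    rw [map_mul, map_ofNat] at this
    simpa using this

theorem exists_BQ (hdeg : Module.finrank ℚ K = 4) (hV4 : ∀ σ : Gal(K/ℚ), σ * σ = 1)
    (F1 F2 F3 : Type*) [Field F1] [NumberField F1] [Algebra F1 K] [Field F2] [NumberField F2] [Algebra F2 K]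
    [Field F3] [NumberField F3] [Algebra F3 K]
    (h1 : Module.finrank ℚ F1 = 2) (h2 : Module.finrank ℚ F2 = 2) (h3 : Module.finrank ℚ F3 = 2)
    (r12 : (algebraMap F1 K).range ≠ (algebraMap F2 K).range)
    (r13 : (algebraMap F1 K).range ≠ (algebraMap F3 K).range)
    (r23 : (algebraMap F2 K).range ≠ (algebraMap F3 K).range) :
    ∃ B : BQ K, (∀ y, B.t1 y = y ↔ y ∈ (algebraMap F1 K).range) ∧ (∀ y, B.t2 y = y ↔ y ∈ (algebraMap F2 K).range) ∧
      (∀ y, B.t3 y = y ↔ y ∈ (algebraMap F3 K).range) ∧ B.d1 = discr F1 ∧ B.d2 = discr F2 ∧ B.d3 = discr F3 := by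
  obtain ⟨t1, n1, f1⟩ := exists_t hdeg F1 h1
  obtain ⟨t2, n2, f2⟩ := exists_t hdeg F2 h2
  obtain ⟨t3, n3, f3⟩ := exists_t hdeg F3 h3
  have n12 : t1 ≠ t2 := by
    rintro rfl
    apply r12; ext y; rw [← f1, ← f2]
  have n13 : t1 ≠ t3 := by
    rintro rfl
    apply r13; ext y; rw [← f1, ← f3]
  have n23 : t2 ≠ t3 := by
    rintro rfl
    apply r23; ext y; rw [← f2, ← f3]
  obtain ⟨δ1, s1, e1, g1, m1, i1⟩ := exists_delta hdeg hV4 F1 h1 n1 f1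
  obtain ⟨δ2, s2, e2, g2, m2, i2⟩ := exists_delta hdeg hV4 F2 h2 n2 f2
  obtain ⟨δ3, s3, e3, g3, m3, i3⟩ := exists_delta hdeg hV4 F3 h3 n3 f3
  exact ⟨⟨t1, t2, t3, four_all hdeg n1 n2 n3 n12 n13 n23, n1, n2, n3, n12, n13, n23, hV4, δ1, δ2, δ3, discr F1, discr F2, discr F3,
    s1, s2, s3, discr_ne_zero F1, discr_ne_zero F2, discr_ne_zero F3, e1, g2 _ n1 n12, g3 _ n1 n13, g1 _ n2 n12.symm, e2,
    g3 _ n2 n23, g1 _ n3 n13.symm, g2 _ n3 n23.symm, e3, m1, m2, m3, i1, i2, i3⟩, f1, f2, f3, rfl, rfl, rfl⟩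

end Constr
end Kuroda


namespace Kuroda
open NumberField NumberField.Units

section Grp

lemma index_formula {G : Type*} [CommGroup G] (R T M2 M3 : Subgroup G) (hM2 : M2 ≤ T) (hM3 : M3 ≤ T)
    (h23 : Nat.card (M2 ⊓ M3 : Subgroup G) = 2) (hRT : R ⊓ T ≤ M2 ⊔ M3) :
    (R ⊔ M2 ⊔ M3).index * (Nat.card M2 * Nat.card M3) = 2 * Nat.card T * (R ⊔ T).index := by
  have c : ∀ {H L : Subgroup G}, H ≤ L → Nat.card H * H.relIndex L = Nat.card L := by
    intro H L h
    rw [← Subgroup.relIndex_bot_left, ← Subgroup.relIndex_bot_left]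
    exact Subgroup.relIndex_mul_relIndex _ _ _ bot_le h
  have hM : Nat.card (M2 ⊔ M3 : Subgroup G) * 2 = Nat.card M2 * Nat.card M3 := by
    have h1 := c (le_sup_right : M3 ≤ M2 ⊔ M3)
    rw [Subgroup.relIndex_sup_right] at h1
    have h2 := c (inf_le_left : M2 ⊓ M3 ≤ M2)
    rw [Subgroup.inf_relIndex_left, h23] at h2
    rw [← h1, ← h2]; ring
  have hE : R ⊔ M2 ⊔ M3 ≤ R ⊔ T := by
    rw [sup_assoc]
    exact sup_le_sup_left (sup_le hM2 hM3) _
  have hET : R ⊔ T = (R ⊔ M2 ⊔ M3) ⊔ T := by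
    rw [sup_assoc, sup_assoc, sup_eq_right.2 hM3, sup_eq_right.2 hM2]
  have hinf : (R ⊔ M2 ⊔ M3) ⊓ T = M2 ⊔ M3 := by
    rw [sup_assoc, sup_comm R, sup_inf_assoc_of_le _ (sup_le hM2 hM3), sup_eq_left]
    exact hRT
  have hrel : (R ⊔ M2 ⊔ M3).relIndex (R ⊔ T) = (M2 ⊔ M3).relIndex T := by
    rw [hET, Subgroup.relIndex_sup_left, ← Subgroup.inf_relIndex_right, hinf]
  have h1 := Subgroup.relIndex_mul_index hE
  have h2 := c (sup_le hM2 hM3)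
  rw [← h1, hrel, ← hM, ← h2]
  ring

end Grp

section Units

lemma unit_range_iff {F K : Type*} [Field F] [NumberField F] [Field K] [NumberField K] [Algebra F K] (u : (𝓞 K)ˣ) :
    (∃ v : (𝓞 F)ˣ, algebraMap (𝓞 F) (𝓞 K) v = u) ↔ algebraMap (𝓞 K) K u ∈ (algebraMap F K).range := by
  constructor
  · rintro ⟨v, hv⟩
    rw [← hv]
    exact ⟨algebraMap (𝓞 F) F v, rfl⟩
  · rintro ⟨x, hx⟩
    have hxi : IsIntegral ℤ x := by
      rw [← isIntegral_algebraMap_iff (B := K) (algebraMap F K).injective, hx]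
      exact RingOfIntegers.isIntegral_coe _
    have hx' : algebraMap F K x⁻¹ = algebraMap (𝓞 K) K (u⁻¹ : (𝓞 K)ˣ) := by
      rw [map_inv₀, hx]
      refine inv_eq_of_mul_eq_one_right ?_
      rw [← map_mul, Units.mul_inv, map_one]
    have hxi' : IsIntegral ℤ x⁻¹ := by
      rw [← isIntegral_algebraMap_iff (B := K) (algebraMap F K).injective, hx']
      exact RingOfIntegers.isIntegral_coe _
    have hx0 : x ≠ 0 := by
      rintro rfl
      rw [map_zero] at hx
      have := (u.isUnit.map (algebraMap (𝓞 K) K)).ne_zero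
      exact this hx.symm
    refine ⟨⟨⟨x, hxi⟩, ⟨x⁻¹, hxi'⟩, ?_, ?_⟩, ?_⟩
    · apply RingOfIntegers.ext
      exact mul_inv_cancel₀ hx0
    · apply RingOfIntegers.ext
      exact inv_mul_cancel₀ hx0
    · apply RingOfIntegers.ext
      exact hx

variable (F : Type*) [Field F] [NumberField F]

lemma torsion_eq_top (h : Units.rank F = 0) : torsion F = ⊤ := by
  rw [eq_top_iff]
  rintro x -
  obtain ⟨⟨ζ, e⟩, hx, -⟩ := exist_unique_eq_mul_prod F x
  have : IsEmpty (Fin (Units.rank F)) := by rw [h]; infer_instance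
  simp only [Finset.univ_eq_empty, Finset.prod_empty, mul_one] at hx
  rw [hx]
  exact ζ.2

lemma regulator_one (h : Units.rank F = 0) : regulator F = 1 := by
  classical
  have hc : Fintype.card (InfinitePlace F) ≤ 1 := by
    unfold Units.rank at h; omega
  let w : InfinitePlace F := Classical.choice inferInstance
  have : IsEmpty {v : InfinitePlace F // v ≠ w} := ⟨fun v ↦ v.2 (Fintype.card_le_one_iff.1 hc _ _)⟩
  have : IsEmpty (Fin (Units.rank F)) := by rw [h]; infer_instance
  rw [regulator_eq_det F w (Equiv.equivOfIsEmpty _ _)]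
  rw [Matrix.det_isEmpty, abs_one]

/-- image of the torsion units -/
def torImg (F K : Type*) [Field F] [NumberField F] [Field K] [NumberField K] [Algebra F K] : Subgroup (𝓞 K)ˣ :=
  (torsion F).map (Units.map (algebraMap (𝓞 F) (𝓞 K)).toMonoidHom)

variable (K : Type*) [Field K] [NumberField K] [Algebra F K]

lemma units_map_inj : Function.Injective (Units.map (algebraMap (𝓞 F) (𝓞 K)).toMonoidHom) := by
  apply Units.map_injective
  intro a b hab
  apply RingOfIntegers.ext
  have := congrArg (algebraMap (𝓞 K) K) hab
  exact (algebraMap F K).injective this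

lemma card_torImg : Nat.card (torImg F K) = torsionOrder F := by
  unfold torImg torsionOrder
  exact (Nat.card_congr ((torsion F).equivMapOfInjective _ (units_map_inj F K)).toEquiv).symm

lemma torImg_le : torImg F K ≤ torsion K := by
  rintro x ⟨y, hy, rfl⟩
  rw [torsion, CommGroup.mem_torsion]
  exact MonoidHom.isOfFinOrder _ ((CommGroup.mem_torsion _).1 hy)

lemma mem_torImg_iff (h : Units.rank F = 0) (u : (𝓞 K)ˣ) :
    u ∈ torImg F K ↔ algebraMap (𝓞 K) K u ∈ (algebraMap F K).range := by
  rw [← unit_range_iff, torImg, torsion_eq_top F h]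
  simp [Units.ext_iff]

lemma neg_one_mem : (-1 : (𝓞 K)ˣ) ∈ torImg F K := by
  refine ⟨-1, ?_, ?_⟩
  · show -1 ∈ torsion F
    rw [torsion, CommGroup.mem_torsion]
    exact isOfFinOrder_iff_pow_eq_one.2 ⟨2, by norm_num, by simp⟩
  · ext; simp

lemma neg_one_ne : (-1 : (𝓞 K)ˣ) ≠ 1 := by
  intro h
  have := congrArg (fun u : (𝓞 K)ˣ ↦ algebraMap (𝓞 K) K u) h
  simp at this
  norm_num at this

lemma sq_unit {u : (𝓞 K)ˣ} (h : u ^ 2 = 1) : u = 1 ∨ u = -1 := by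
  have : (u : 𝓞 K) * u = 1 := by rw [← sq, ← Units.val_pow_eq_pow_val, h, Units.val_one]
  rcases mul_self_eq_one_iff.1 this with h | h
  · left; ext; simp [h]
  · right; ext; simp [h]

lemma real_torsion [IsCMField K] {u : (𝓞 K)ˣ} (h : u ∈ IsCMField.realUnits K) (ht : u ∈ torsion K) : u = 1 ∨ u = -1 := by
  apply sq_unit
  have h1 := (IsCMField.unitsComplexConj_eq_self_iff K u).2 h
  have h2 := IsCMField.unitsComplexConj_torsion K ⟨u, ht⟩
  rw [sq]
  have h2 : IsCMField.unitsComplexConj K u = u⁻¹ := by simpa using h2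
  rw [h1] at h2
  nth_rewrite 1 [h2]
  simp

lemma torsionOrder_real [IsCMField K] : torsionOrder (maximalRealSubfield K) = 2 := by
  classical
  have he := even_torsionOrder (maximalRealSubfield K)
  have hp := torsionOrder_pos (maximalRealSubfield K)
  have hle : torsionOrder (maximalRealSubfield K) ≤ 2 := by
    rw [← card_torImg _ K]
    have hsub : (torImg (maximalRealSubfield K) K : Set (𝓞 K)ˣ) ⊆ ({1, -1} : Finset (𝓞 K)ˣ) := by
      intro u hu
      have h2 := torImg_le _ K hu
      obtain ⟨v, hv, rfl⟩ := hu
      have := real_torsion K ⟨v, rfl⟩ h2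
      simpa using this
    have := Set.ncard_le_ncard hsub
    rw [Set.ncard_coe_finset] at this
    exact this.trans Finset.card_le_two
  obtain ⟨m, hm⟩ := he
  omega

end Units
end Kuroda


namespace Kuroda
open NumberField NumberField.Units NumberField.InfinitePlace

section Core

variable (K : Type*) [Field K] [NumberField K] [IsGalois ℚ K] [IsCMField K]

/-- complex conjugation as an automorphism over `ℚ` -/
noncomputable def cc : Gal(K/ℚ) := (IsCMField.complexConj K).restrictScalars ℚ

lemma cc_fix (y : K) : cc K y = y ↔ y ∈ (algebraMap (maximalRealSubfield K) K).range := by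
  have : cc K y = IsCMField.complexConj K y := rfl
  rw [this, IsCMField.complexConj_eq_self_iff]
  constructor
  · intro h; exact ⟨⟨y, h⟩, rfl⟩
  · rintro ⟨x, rfl⟩; exact x.2

lemma cc_ne : cc K ≠ 1 := by
  intro h
  apply IsCMField.complexConj_ne_one K
  ext x
  exact congrArg (fun g : Gal(K/ℚ) ↦ g x) h

lemma finrank_real (hdeg : Module.finrank ℚ K = 4) : Module.finrank ℚ (maximalRealSubfield K) = 2 := by
  have h := Module.finrank_mul_finrank ℚ (maximalRealSubfield K) K
  rw [hdeg, Algebra.IsQuadraticExtension.finrank_eq_two (maximalRealSubfield K) K] at h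
  omega

lemma totComplex (F : Type*) [Field F] [NumberField F] [Algebra F K] {δ : K} (hδ : δ ∈ (algebraMap F K).range) (h0 : δ ≠ 0)
    (hc : cc K δ = -δ) : IsTotallyComplex F := by
  refine ⟨fun w ↦ ?_⟩
  rw [← not_isReal_iff_isComplex]
  intro hw
  obtain ⟨e, rfl⟩ := hδ
  have hr := isReal_iff.1 hw
  have h1 := congrArg (fun φ : F →+* ℂ ↦ φ e) hr
  have hlift := ComplexEmbedding.lift_algebraMap_apply K w.embedding e
  have h2 := IsCMField.complexEmbedding_complexConj K (ComplexEmbedding.lift K w.embedding) (algebraMap F K e)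
  have hc' : IsCMField.complexConj K (algebraMap F K e) = -(algebraMap F K e) := hc
  rw [hc', map_neg, hlift] at h2
  have h1 : (starRingEnd ℂ) (w.embedding e) = w.embedding e := h1
  rw [h1] at h2
  have h3 : w.embedding e = 0 := by linear_combination (-1/2) * h2
  apply h0
  rw [(map_eq_zero _).1 h3, map_zero]

lemma rank_zero (F : Type*) [Field F] [NumberField F] [IsTotallyComplex F] (h : Module.finrank ℚ F = 2) : nrComplexPlaces F = 1 ∧
    Units.rank F = 0 := by
  have h1 := IsTotallyComplex.finrank (K := F)
  have h2 := card_eq_nrRealPlaces_add_nrComplexPlaces F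
  have h3 := IsTotallyComplex.nrRealPlaces_eq_zero (K := F)
  refine ⟨by omega, ?_⟩
  unfold Units.rank
  omega

/-- the three families of units -/
lemma closure_eq (F2 F3 : Type*) [Field F2] [NumberField F2] [Algebra F2 K] [Field F3] [NumberField F3] [Algebra F3 K]
    (k2 : Units.rank F2 = 0) (k3 : Units.rank F3 = 0) :
    Subgroup.closure {u : (𝓞 K)ˣ | algebraMap (𝓞 K) K u ∈ ((algebraMap (maximalRealSubfield K) K).range : Set K) ∪
      ((algebraMap F2 K).range : Set K) ∪ ((algebraMap F3 K).range : Set K)} =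
    IsCMField.realUnits K ⊔ torImg F2 K ⊔ torImg F3 K := by
  have : {u : (𝓞 K)ˣ | algebraMap (𝓞 K) K u ∈ ((algebraMap (maximalRealSubfield K) K).range : Set K) ∪
      ((algebraMap F2 K).range : Set K) ∪ ((algebraMap F3 K).range : Set K)} =
      (IsCMField.realUnits K : Set (𝓞 K)ˣ) ∪ (torImg F2 K : Set (𝓞 K)ˣ) ∪ (torImg F3 K : Set (𝓞 K)ˣ) := by
    ext u
    have e1 : u ∈ IsCMField.realUnits K ↔ algebraMap (𝓞 K) K u ∈ (algebraMap (maximalRealSubfield K) K).range := by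
      rw [IsCMField.mem_realUnits_iff]
      exact unit_range_iff u
    have e2 := mem_torImg_iff F2 K k2 u
    have e3 := mem_torImg_iff F3 K k3 u
    simp only [Set.mem_union, SetLike.mem_coe, e1, e2, e3]
    rfl
  rw [this, Subgroup.closure_union, Subgroup.closure_union, Subgroup.closure_eq, Subgroup.closure_eq, Subgroup.closure_eq]

theorem core (hdeg : Module.finrank ℚ K = 4) (hV4 : ∀ σ : Gal(K/ℚ), σ * σ = 1)
    (F2 F3 : Type*) [Field F2] [NumberField F2] [Algebra F2 K] [Field F3] [NumberField F3] [Algebra F3 K]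
    (h2 : Module.finrank ℚ F2 = 2) (h3 : Module.finrank ℚ F3 = 2)
    (r12 : (algebraMap (maximalRealSubfield K) K).range ≠ (algebraMap F2 K).range)
    (r13 : (algebraMap (maximalRealSubfield K) K).range ≠ (algebraMap F3 K).range)
    (r23 : (algebraMap F2 K).range ≠ (algebraMap F3 K).range) :
    2 * classNumber K = (Subgroup.closure {u : (𝓞 K)ˣ | algebraMap (𝓞 K) K u ∈
      ((algebraMap (maximalRealSubfield K) K).range : Set K) ∪
      ((algebraMap F2 K).range : Set K) ∪ ((algebraMap F3 K).range : Set K)}).index *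
      (classNumber (maximalRealSubfield K) * classNumber F2 * classNumber F3) := by
  have h1 := finrank_real K hdeg
  obtain ⟨B, f1, f2, f3, e1, e2, e3⟩ := exists_BQ hdeg hV4 (maximalRealSubfield K) F2 F3 h1 h2 h3 r12 r13 r23
  have hres := residue_identity K hdeg hV4 (maximalRealSubfield K) F2 F3 h1 h2 h3 B.t1 B.t2 B.t3 B.n1 B.n2 B.n3 B.n12 B.n13 B.n23
    (fun x ↦ (f1 _).2 ⟨x, rfl⟩) (fun x ↦ (f2 _).2 ⟨x, rfl⟩) (fun x ↦ (f3 _).2 ⟨x, rfl⟩) B.mul12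
  have hdisc := B.discr_eq
  rw [e1, e2, e3] at hdisc
  have hc1 : cc K B.δ1 = B.δ1 := (cc_fix K _).2 ((f1 _).1 B.a11)
  have nz1 : B.δ1 ≠ -B.δ1 := by
    intro h
    apply B.nz1
    linear_combination (1/2) * h
  have hcc : cc K = B.t1 := by
    rcases B.hall (cc K) with h | h | h | h
    · exact absurd h (cc_ne K)
    · exact h
    · rw [h, B.a21] at hc1; exact absurd hc1.symm nz1
    · rw [h, B.a31] at hc1; exact absurd hc1.symm nz1
  haveI c2 : IsTotallyComplex F2 := totComplex K F2 ((f2 _).1 B.a22) B.nz2 (by rw [hcc, B.a12])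
  haveI c3 : IsTotallyComplex F3 := totComplex K F3 ((f3 _).1 B.a33) B.nz3 (by rw [hcc, B.a13])
  obtain ⟨p2, k2⟩ := rank_zero F2 h2
  obtain ⟨p3, k3⟩ := rank_zero F3 h3
  have q2 := IsTotallyComplex.nrRealPlaces_eq_zero (K := F2)
  have q3 := IsTotallyComplex.nrRealPlaces_eq_zero (K := F3)
  have q := IsTotallyComplex.nrRealPlaces_eq_zero (K := K)
  have p : nrComplexPlaces K = 2 := by
    have := IsTotallyComplex.finrank (K := K)
    omega
  have k : Units.rank K = 1 := by
    have := card_eq_nrRealPlaces_add_nrComplexPlaces K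
    unfold Units.rank
    omega
  have p1 := IsTotallyReal.nrComplexPlaces_eq_zero (K := maximalRealSubfield K)
  have q1 : nrRealPlaces (maximalRealSubfield K) = 2 := by
    have := IsTotallyReal.finrank (K := maximalRealSubfield K)
    omega
  -- units
  have hidx := index_formula (IsCMField.realUnits K) (torsion K) (torImg F2 K) (torImg F3 K) (torImg_le F2 K) (torImg_le F3 K)
    (by
      have hset : ((torImg F2 K ⊓ torImg F3 K : Subgroup (𝓞 K)ˣ) : Set (𝓞 K)ˣ) = {1, -1} := by
        ext u
        constructor
        · rintro ⟨hu2, hu3⟩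
          have g2 := (f2 _).2 ((mem_torImg_iff F2 K k2 u).1 hu2)
          have g3 := (f3 _).2 ((mem_torImg_iff F3 K k3 u).1 hu3)
          have g1 : B.t1 (algebraMap (𝓞 K) K u) = algebraMap (𝓞 K) K u := by
            rw [← B.app23, g3, g2]
          have hR : u ∈ IsCMField.realUnits K := by
            rw [IsCMField.mem_realUnits_iff]
            exact (unit_range_iff u).2 ((f1 _).1 g1)
          exact real_torsion K hR (torImg_le F2 K hu2)
        · rintro (rfl | rfl)
          · exact one_mem _
          · exact ⟨neg_one_mem F2 K, neg_one_mem F3 K⟩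
      have := Set.ncard_pair (neg_one_ne K).symm
      rw [← hset] at this
      exact this)
    (by
      rintro u ⟨hu1, hu2⟩
      apply Subgroup.mem_sup_left
      rcases real_torsion K hu1 hu2 with rfl | rfl
      · exact one_mem _
      · exact neg_one_mem F2 K)
  rw [closure_eq K F2 F3 k2 k3]
  rw [card_torImg, card_torImg] at hidx
  have hreg := IsCMField.regulator_div_regulator_eq_two_pow_mul_indexRealUnits_inv K
  rw [k, pow_one] at hreg
  have htor := torsionOrder_real K
  rw [dedekindZeta_residue_def, dedekindZeta_residue_def, dedekindZeta_residue_def, dedekindZeta_residue_def,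
    regulator_one F2 k2, regulator_one F3 k3, htor, p, q, p1, q1, p2, q2, p3, q3] at hres
  have hi0 : (IsCMField.indexRealUnits K) ≠ 0 := by
    rcases IsCMField.indexRealUnits_eq_one_or_two K with h | h <;> omega
  change _ = 2 * torsionOrder K * IsCMField.indexRealUnits K at hidx
  have hs : √(|(discr K : ℤ)| : ℝ) = √(|(discr (maximalRealSubfield K) : ℤ)| : ℝ) * √(|(discr F2 : ℤ)| : ℝ) * √(|(discr F3 : ℤ)| : ℝ) := by
    rw [hdisc]
    push_cast
    rw [abs_mul, abs_mul, Real.sqrt_mul (by positivity), Real.sqrt_mul (by positivity)]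
  generalize (IsCMField.realUnits K ⊔ torImg F2 K ⊔ torImg F3 K).index = Q at *
  push_cast at hres
  rw [hs] at hres
  have sd1 : 0 < √(|(discr (maximalRealSubfield K) : ℤ)| : ℝ) := Real.sqrt_pos.2 (abs_pos.2 (by exact_mod_cast discr_ne_zero _))
  have sd2 : 0 < √(|(discr F2 : ℤ)| : ℝ) := Real.sqrt_pos.2 (abs_pos.2 (by exact_mod_cast discr_ne_zero _))
  have sd3 : 0 < √(|(discr F3 : ℤ)| : ℝ) := Real.sqrt_pos.2 (abs_pos.2 (by exact_mod_cast discr_ne_zero _))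
  generalize √(|(discr (maximalRealSubfield K) : ℤ)| : ℝ) = s1 at *
  generalize √(|(discr F2 : ℤ)| : ℝ) = s2 at *
  generalize √(|(discr F3 : ℤ)| : ℝ) = s3 at *
  have rp := regulator_pos K
  have rp1 := regulator_pos (maximalRealSubfield K)
  have w0 := torsionOrder_pos K
  have w2p := torsionOrder_pos F2
  have w3p := torsionOrder_pos F3
  have hidx' : (Q : ℝ) * (torsionOrder F2 * torsionOrder F3) = 2 * torsionOrder K * IsCMField.indexRealUnits K := by
    exact_mod_cast hidx
  generalize IsCMField.indexRealUnits K = I at *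
  generalize regulator K = RK at *
  generalize regulator (maximalRealSubfield K) = R1 at *
  generalize torsionOrder K = wK at *
  generalize torsionOrder F2 = w2 at *
  generalize torsionOrder F3 = w3 at *
  have hI : (0:ℝ) < I := by exact_mod_cast Nat.pos_of_ne_zero hi0
  have hw : (0:ℝ) < wK := by exact_mod_cast w0
  have hw2 : (0:ℝ) < w2 := by exact_mod_cast w2p
  have hw3 : (0:ℝ) < w3 := by exact_mod_cast w3p
  have hpi := Real.pi_pos
  have goal : (2 * classNumber K : ℝ) = Q * (classNumber (maximalRealSubfield K) * classNumber F2 * classNumber F3) := by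
    generalize (classNumber K : ℝ) = H at *
    generalize (classNumber (maximalRealSubfield K) : ℝ) = H1 at *
    generalize (classNumber F2 : ℝ) = H2 at *
    generalize (classNumber F3 : ℝ) = H3 at *
    have hRK : RK * I = 2 * R1 := by
      field_simp at hreg
      linarith
    have hres' : RK * H * w2 * w3 = 2 * R1 * H1 * H2 * H3 * wK := by
      field_simp at hres
      nlinarith
    have : (R1 * (w2 * w3)) * (2 * H) = (R1 * (w2 * w3)) * (Q * (H1 * H2 * H3)) := by
      linear_combination (-H * w2 * w3) * hRK + I * hres' - (R1 * H1 * H2 * H3) * hidx'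
    exact mul_left_cancel₀ (by positivity) this
  exact_mod_cast goal

end Core
end Kuroda


namespace Kuroda
open NumberField NumberField.InfinitePlace

section Final

variable (K : Type*) [Field K] [NumberField K] [IsGalois ℚ K]

lemma classNumber_congr {F L : Type*} [Field F] [NumberField F] [Field L] [NumberField L] (e : F ≃+* L) :
    classNumber F = classNumber L :=
  Fintype.card_congr (ClassGroup.mulEquiv (RingOfIntegers.mapRingEquiv e)).toEquiv

theorem core' [IsCMField K] (hdeg : Module.finrank ℚ K = 4) (hV4 : ∀ σ : Gal(K/ℚ), σ * σ = 1)
    (K1 K2 K3 : Type*) [Field K1] [NumberField K1] [Field K2] [NumberField K2]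
    [Field K3] [NumberField K3]
    (f1 : K1 →+* K) (f2 : K2 →+* K) (f3 : K3 →+* K) (hd2 : Module.finrank ℚ K2 = 2)
    (hd3 : Module.finrank ℚ K3 = 2)
    (r12 : f1.range ≠ f2.range) (r13 : f1.range ≠ f3.range) (r23 : f2.range ≠ f3.range)
    (hreal : f1.range = (algebraMap (maximalRealSubfield K) K).range) :
    2 * classNumber K =
      (Subgroup.closure {u : (𝓞 K)ˣ |
          algebraMap (𝓞 K) K u ∈ (f1.range : Set K) ∪ (f2.range : Set K)
            ∪ (f3.range : Set K)}).index
        * (classNumber K1 * classNumber K2 * classNumber K3) := by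
  letI := f2.toAlgebra
  letI := f3.toAlgebra
  have heq : f1.fieldRange = maximalRealSubfield K := by
    ext y
    have h1 : y ∈ f1.fieldRange ↔ y ∈ f1.range := Iff.rfl
    rw [h1, hreal]
    constructor
    · rintro ⟨x, rfl⟩; exact x.2
    · intro h; exact ⟨⟨y, h⟩, rfl⟩
  have hcl : classNumber K1 = classNumber (maximalRealSubfield K) :=
    classNumber_congr (f1.rangeRestrictFieldEquiv.trans (RingEquiv.subfieldCongr heq))
  rw [hcl, hreal]
  rw [hreal] at r12 r13
  exact core K hdeg hV4 K2 K3 hd2 hd3 r12 r13 r23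

lemma totComplex_of_gal (himag : ∃ v : InfinitePlace K, v.IsComplex) : IsTotallyComplex K := by
  obtain ⟨v, hv⟩ := himag
  refine ⟨fun w ↦ ?_⟩
  obtain ⟨σ, rfl⟩ := InfinitePlace.exists_smul_eq_of_comap_eq (k := ℚ) (w := v) (w' := w) (Subsingleton.elim _ _)
  exact InfinitePlace.isComplex_smul_iff.2 hv

theorem final (hdeg : Module.finrank ℚ K = 4) (hV4 : ∀ σ : Gal(K/ℚ), σ * σ = 1)
    (himag : ∃ v : InfinitePlace K, v.IsComplex)
    (K1 K2 K3 : Type*) [Field K1] [NumberField K1] [Field K2] [NumberField K2]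
    [Field K3] [NumberField K3]
    (f1 : K1 →+* K) (f2 : K2 →+* K) (f3 : K3 →+* K)
    (hd1 : Module.finrank ℚ K1 = 2) (hd2 : Module.finrank ℚ K2 = 2)
    (hd3 : Module.finrank ℚ K3 = 2)
    (hdist : f1.range ≠ f2.range ∧ f1.range ≠ f3.range ∧ f2.range ≠ f3.range) :
    2 * classNumber K =
      (Subgroup.closure {u : (𝓞 K)ˣ |
          algebraMap (𝓞 K) K u ∈ (f1.range : Set K) ∪ (f2.range : Set K)
            ∪ (f3.range : Set K)}).index
        * (classNumber K1 * classNumber K2 * classNumber K3) := by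
  have := totComplex_of_gal K himag
  have hcomm : ∀ a b : Gal(K/ℚ), a * b = b * a := by
    intro a b
    have inv : ∀ c : Gal(K/ℚ), c⁻¹ = c := fun c ↦ inv_eq_of_mul_eq_one_left (hV4 c)
    have := inv (a * b)
    rw [mul_inv_rev, inv, inv] at this
    exact this.symm
  have : IsMulCommutative Gal(K/ℚ) := ⟨⟨hcomm⟩⟩
  have : IsAbelianGalois ℚ K := {}
  have : IsCMField K := IsCMField.of_isAbelianGalois K
  obtain ⟨r12, r13, r23⟩ := hdist
  letI := f1.toAlgebra
  letI := f2.toAlgebra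
  letI := f3.toAlgebra
  obtain ⟨B, g1, g2, g3, -⟩ := exists_BQ hdeg hV4 K1 K2 K3 hd1 hd2 hd3 r12 r13 r23
  rcases B.hall (cc K) with h | h | h | h
  · exact absurd h (cc_ne K)
  · refine core' K hdeg hV4 K1 K2 K3 f1 f2 f3 hd2 hd3 r12 r13 r23 ?_
    ext y
    rw [← cc_fix, h]
    exact (g1 y).symm
  · have := core' K hdeg hV4 K2 K1 K3 f2 f1 f3 hd1 hd3 r12.symm r23 r13 (by
      ext y
      rw [← cc_fix, h]
      exact (g2 y).symm)
    rw [this, Set.union_comm (f2.range : Set K), mul_comm (classNumber K2)]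
  · have := core' K hdeg hV4 K3 K1 K2 f3 f1 f2 hd1 hd2 r13.symm r23.symm r12 (by
      ext y
      rw [← cc_fix, h]
      exact (g3 y).symm)
    rw [this, Set.union_assoc (f3.range : Set K), Set.union_comm (f3.range : Set K), mul_assoc (classNumber K3),
      mul_comm (classNumber K3)]

end Final
end Kuroda


open NumberField in
/-- Kuroda's class number formula for an imaginary `V₄`-extension `K/ℚ`:
`h(K) = (1/2)·Q(K/ℚ)·h(k₁)h(k₂)h(k₃)` where `k₁, k₂, k₃` are the three
quadratic subfields of `K` and `Q(K/ℚ) = [E_K : E_{k₁}E_{k₂}E_{k₃}]`. -/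
theorem stmt15 (K : Type) [Field K] [NumberField K] [IsGalois ℚ K]
    (hdeg : Module.finrank ℚ K = 4)
    (hV4 : ∀ σ : K ≃ₐ[ℚ] K, σ * σ = 1)
    (himag : ∃ v : InfinitePlace K, v.IsComplex)
    (K1 K2 K3 : Type) [Field K1] [NumberField K1] [Field K2] [NumberField K2]
    [Field K3] [NumberField K3]
    (f1 : K1 →+* K) (f2 : K2 →+* K) (f3 : K3 →+* K)
    (hd1 : Module.finrank ℚ K1 = 2) (hd2 : Module.finrank ℚ K2 = 2)
    (hd3 : Module.finrank ℚ K3 = 2)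
    (hdist : f1.range ≠ f2.range ∧ f1.range ≠ f3.range ∧ f2.range ≠ f3.range) :
    2 * classNumber K =
      (Subgroup.closure {u : (𝓞 K)ˣ |
          algebraMap (𝓞 K) K u ∈ (f1.range : Set K) ∪ (f2.range : Set K)
            ∪ (f3.range : Set K)}).index
        * (classNumber K1 * classNumber K2 * classNumber K3) := by
  exact Kuroda.final K hdeg hV4 himag K1 K2 K3 f1 f2 f3 hd1 hd2 hd3 hdist
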